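/- arXiv:0911.0278 — 3 statements merged into one kernel-verified Lean document; each statement's English description precedes it below -/
import Mathlib

section
/- If H is a finite-index subgroup of PSL(2,ℤ) isomorphic to a free product of n₀ copies of ℤ, n₂ copies of ℤ/2, and n₃ copies of ℤ/3, then [PSL(2,ℤ):H] = 6n₀ + 3n₂ + 4n₃ − 6. -/
/-- `SL(2,ℤ)`. -/
abbrev SL2Z := Matrix.SpecialLinearGroup (Fin 2) ℤ

/-- The modular group `PSL(2,ℤ) = SL(2,ℤ)/{±1}`. -/
abbrev PSL2Z := SL2Z ⧸ Subgroup.center SL2Z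

/-- A family of groups indexed by `ι₀ ⊕ (ι₂ ⊕ ι₃)` consisting of copies of
`ℤ` (indexed by `ι₀`), `ℤ/2` (indexed by `ι₂`) and `ℤ/3` (indexed by `ι₃`). -/
def FPfactor (ι₀ ι₂ ι₃ : Type) : ι₀ ⊕ (ι₂ ⊕ ι₃) → Type
  | Sum.inl _ => Multiplicative ℤ
  | Sum.inr (Sum.inl _) => Multiplicative (ZMod 2)
  | Sum.inr (Sum.inr _) => Multiplicative (ZMod 3)

instance FPfactor.group (ι₀ ι₂ ι₃ : Type) :
    (i : ι₀ ⊕ (ι₂ ⊕ ι₃)) → Group (FPfactor ι₀ ι₂ ι₃ i)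
  | Sum.inl _ => inferInstanceAs (Group (Multiplicative ℤ))
  | Sum.inr (Sum.inl _) => inferInstanceAs (Group (Multiplicative (ZMod 2)))
  | Sum.inr (Sum.inr _) => inferInstanceAs (Group (Multiplicative (ZMod 3)))

/-- Homomorphisms out of `ℤ/n` are the `n`-torsion elements of the target. -/
def zmodHomEquiv (n : ℕ) (G : Type*) [Group G] :
    (Multiplicative (ZMod n) →* G) ≃ {g : G // g ^ n = 1} :=
  (AddMonoidHom.toMultiplicativeLeft (α := ZMod n) (β := G)).symm.trans <|
    (ZMod.lift n (A := Additive G)).symm.trans <|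
      (zmultiplesHom (Additive G)).symm.subtypeEquiv <| by
        intro f
        have h : f n = n • f 1 := by rw [← map_nsmul]; simp
        rw [h]
        rfl

lemma zmodHomEquiv_apply (n : ℕ) (G : Type*) [Group G] (f : Multiplicative (ZMod n) →* G) :
    (zmodHomEquiv n G f : G) = f (Multiplicative.ofAdd 1) := by
  change f (Multiplicative.ofAdd ((1 : ℤ) : ZMod n)) = _
  simp

lemma zmodHomEquiv_symm_apply (n : ℕ) [NeZero n] (G : Type*) [Group G] (g : {g : G // g ^ n = 1})
    (a : Multiplicative (ZMod n)) :
    (zmodHomEquiv n G).symm g a = (g : G) ^ a.toAdd.val := by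
  obtain ⟨f, rfl⟩ := (zmodHomEquiv n G).surjective g
  rw [Equiv.symm_apply_apply, zmodHomEquiv_apply, ← map_pow]
  congr 1
  change a.toAdd = a.toAdd.val • (1 : ZMod n)
  simp

/-- Homomorphisms out of a free product of cyclic groups of orders `∞`, `2` and `3`. -/
noncomputable def coprodFPfactorHomEquiv (ι₀ ι₂ ι₃ : Type) (G : Type*) [Group G] :
    (Monoid.CoprodI (FPfactor ι₀ ι₂ ι₃) →* G) ≃
      (ι₀ → G) × (ι₂ → {g : G // g ^ 2 = 1}) × (ι₃ → {g : G // g ^ 3 = 1}) :=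
  Monoid.CoprodI.lift.symm.trans <| (Equiv.sumPiEquivProdPi _).trans <|
    Equiv.prodCongr (Equiv.piCongrRight fun _ ↦ (zpowersHom G).symm) <|
      (Equiv.sumPiEquivProdPi _).trans <|
        Equiv.prodCongr (Equiv.piCongrRight fun _ ↦ zmodHomEquiv 2 G)
          (Equiv.piCongrRight fun _ ↦ zmodHomEquiv 3 G)

lemma card_coprodFPfactor_hom (n₀ n₂ n₃ : ℕ) (K : Type*) [Group K] :
    Nat.card (Monoid.CoprodI (FPfactor (Fin n₀) (Fin n₂) (Fin n₃)) →* K) =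
      Nat.card K ^ n₀ * (Nat.card {k : K // k ^ 2 = 1} ^ n₂ *
        Nat.card {k : K // k ^ 3 = 1} ^ n₃) := by
  rw [Nat.card_congr (coprodFPfactorHomEquiv _ _ _ K)]
  simp [Nat.card_prod, Nat.card_fun]

namespace PSL2Z

open ModularGroup Matrix

/-- The involution `z ↦ -1 / z`. -/
def S : PSL2Z := QuotientGroup.mk ModularGroup.S

/-- The order three element `z ↦ 1 / (1 - z)`. -/
def U : PSL2Z := QuotientGroup.mk (ModularGroup.S * ModularGroup.T⁻¹)

lemma S_sq : S ^ 2 = 1 := by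
  rw [S, ← QuotientGroup.mk_pow, QuotientGroup.eq_one_iff, Matrix.SpecialLinearGroup.mem_center_iff]
  refine ⟨-1, by simp, ?_⟩
  decide

lemma U_pow_three : U ^ 3 = 1 := by
  rw [U, ← QuotientGroup.mk_pow, QuotientGroup.eq_one_iff]
  convert Subgroup.one_mem _
  decide

lemma closure_S_U : Subgroup.closure {S, U} = ⊤ := by
  have hS : S ∈ Subgroup.closure {S, U} := Subgroup.subset_closure (by simp)
  have hU : U ∈ Subgroup.closure {S, U} := Subgroup.subset_closure (by simp)
  have h := congrArg (Subgroup.map (QuotientGroup.mk' (Subgroup.center SL2Z)))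
    SpecialLinearGroup.SL2Z_generators
  rw [Subgroup.map_top_of_surjective _ (QuotientGroup.mk'_surjective _),
    MonoidHom.map_closure] at h
  rw [eq_top_iff, ← h, Subgroup.closure_le]
  rintro _ ⟨g, rfl | rfl, rfl⟩
  · exact hS
  · have : (QuotientGroup.mk' (Subgroup.center SL2Z)) ModularGroup.T = U⁻¹ * S := by
      simp [U, S]
    rw [this]
    exact mul_mem (inv_mem hU) hS

/-- The classes of matrices whose first column `(a, c)` has `r a c` positive. -/
def signSet (r : ℤ) : Set PSL2Z :=
  {γ | ∃ g : SL2Z, QuotientGroup.mk g = γ ∧ 0 < r * (g 0 0 * g 1 0)}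

lemma mem_signSet {r : ℤ} {g : SL2Z} :
    (QuotientGroup.mk g : PSL2Z) ∈ signSet r ↔ 0 < r * (g 0 0 * g 1 0) := by
  refine ⟨?_, fun h ↦ ⟨g, rfl, h⟩⟩
  rintro ⟨h, hgh, hpos⟩
  obtain ⟨s, hs, hsc⟩ := Matrix.SpecialLinearGroup.mem_center_iff.mp
    (QuotientGroup.eq.mp hgh)
  obtain ⟨z, rfl⟩ : ∃ z, g = h * z := ⟨h⁻¹ * g, by simp⟩
  rw [inv_mul_cancel_left, Matrix.scalar_apply] at hsc
  have hs' : s ^ 2 = 1 := by simpa using hs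
  have h0 : s = z 0 0 := by simpa using congrFun (congrFun hsc 0) 0
  have h1 : 0 = z 1 0 := by simpa using congrFun (congrFun hsc 1) 0
  have hmul (i : Fin 2) : (h * z) i 0 = h i 0 * z 0 0 + h i 1 * z 1 0 := by
    simp [Matrix.mul_apply, Fin.sum_univ_two]
  rw [hmul, hmul, ← h0, ← h1]
  convert hpos using 1
  linear_combination (r * (h 0 0 * h 1 0)) * hs'

open scoped Pointwise in
lemma smul_signSet_subset {g : SL2Z} {r s x y z w : ℤ}
    (hg : (g : Matrix (Fin 2) (Fin 2) ℤ) = !![x, y; z, w])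
    (h : ∀ a c : ℤ, 0 < r * (a * c) → 0 < s * ((x * a + y * c) * (z * a + w * c))) :
    (QuotientGroup.mk g : PSL2Z) • signSet r ⊆ signSet s := by
  rintro _ ⟨γ, hγ, rfl⟩
  induction γ using QuotientGroup.induction_on with
  | H k =>
    have := h _ _ (mem_signSet.mp hγ)
    change QuotientGroup.mk (g * k) ∈ _
    rw [mem_signSet]
    simpa [Matrix.mul_apply, Fin.sum_univ_two, hg] using this

/-- The canonical map from the free product of `ℤ/2` and `ℤ/3` onto the modular group. -/
noncomputable def ofCoprod :
    Monoid.CoprodI (FPfactor (Fin 0) (Fin 1) (Fin 1)) →* PSL2Z :=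
  (coprodFPfactorHomEquiv _ _ _ PSL2Z).symm
    ⟨Fin.elim0, fun _ ↦ ⟨S, S_sq⟩, fun _ ↦ ⟨U, U_pow_three⟩⟩


lemma ofCoprod_apply_two (i : Fin 1) (a : Multiplicative (ZMod 2)) :
    ofCoprod (Monoid.CoprodI.of (i := Sum.inr (Sum.inl i)) a) = S ^ a.toAdd.val :=
  (Monoid.CoprodI.lift_of _ _).trans (zmodHomEquiv_symm_apply 2 _ ⟨S, S_sq⟩ a)

lemma ofCoprod_apply_three (i : Fin 1) (a : Multiplicative (ZMod 3)) :
    ofCoprod (Monoid.CoprodI.of (i := Sum.inr (Sum.inr i)) a) = U ^ a.toAdd.val :=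
  (Monoid.CoprodI.lift_of _ _).trans (zmodHomEquiv_symm_apply 3 _ ⟨U, U_pow_three⟩ a)

lemma ofCoprod_surjective : Function.Surjective ofCoprod := by
  rw [← MonoidHom.range_eq_top, eq_top_iff, ← closure_S_U, Subgroup.closure_le]
  rintro _ (rfl | rfl)
  · exact ⟨_, (ofCoprod_apply_two 0 (Multiplicative.ofAdd 1)).trans (pow_one _)⟩
  · exact ⟨_, (ofCoprod_apply_three 0 (Multiplicative.ofAdd 1)).trans (pow_one _)⟩

open scoped Pointwise in
lemma ofCoprod_injective : Function.Injective ofCoprod := by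
  let X : Fin 0 ⊕ (Fin 1 ⊕ Fin 1) → Set PSL2Z :=
    Sum.elim Fin.elim0 (Sum.elim (fun _ ↦ signSet (-1)) fun _ ↦ signSet 1)
  have : Nontrivial (Fin 0 ⊕ (Fin 1 ⊕ Fin 1)) :=
    ⟨Sum.inr (Sum.inl 0), Sum.inr (Sum.inr 0), by simp⟩
  rw [← Monoid.CoprodI.lift.apply_symm_apply ofCoprod]
  refine Monoid.CoprodI.lift_injective_of_ping_pong _
    (Or.inr ⟨Sum.inr (Sum.inr 0), ?_⟩) X ?_ ?_ ?_
  · change 3 ≤ Cardinal.mk (ZMod 3)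
    simp [Cardinal.mk_fintype]
  · rintro (i | i | i)
    · exact i.elim0
    · exact ⟨QuotientGroup.mk (ModularGroup.T⁻¹ * ModularGroup.S * ModularGroup.T),
        mem_signSet.mpr (by decide)⟩
    · exact ⟨QuotientGroup.mk (ModularGroup.T * ModularGroup.S * ModularGroup.T),
        mem_signSet.mpr (by decide)⟩
  · have h : Disjoint (signSet (-1)) (signSet 1) := by
      rw [Set.disjoint_left]
      intro γ h₁ h₂
      induction γ using QuotientGroup.induction_on with
      | H g =>
        rw [mem_signSet] at h₁ h₂
        linarith
    rintro (⟨_, ⟨⟩⟩ | i | i) (⟨_, ⟨⟩⟩ | j | j) hij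
    · exact absurd (congrArg _ (congrArg _ (Subsingleton.elim i j))) hij
    · exact h
    · exact h.symm
    · exact absurd (congrArg _ (congrArg _ (Subsingleton.elim i j))) hij
  · rintro (⟨_, ⟨⟩⟩ | i | i) (⟨_, ⟨⟩⟩ | j | j) hij a ha
    · exact absurd (congrArg _ (congrArg _ (Subsingleton.elim i j))) hij
    · refine (congrArg (· • signSet 1) (ofCoprod_apply_two i a)).subset.trans ?_
      change ZMod 2 at a
      change a ≠ 0 at ha
      fin_cases a
      · exact absurd rfl ha
      · refine smul_signSet_subset (g := ModularGroup.S ^ 1) (x := 0) (y := -1) (z := 1) (w := 0)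
          (by decide) fun a c h ↦ ?_
        linarith
    · refine (congrArg (· • signSet (-1)) (ofCoprod_apply_three i a)).subset.trans ?_
      change ZMod 3 at a
      change a ≠ 0 at ha
      fin_cases a
      · exact absurd rfl ha
      · refine smul_signSet_subset (g := (ModularGroup.S * ModularGroup.T⁻¹) ^ 1)
          (x := 0) (y := -1) (z := 1) (w := -1) (by decide) fun a c h ↦ ?_
        nlinarith [sq_nonneg c]
      · refine smul_signSet_subset (g := (ModularGroup.S * ModularGroup.T⁻¹) ^ 2)
          (x := -1) (y := 1) (z := -1) (w := 0) (by decide) fun a c h ↦ ?_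
        nlinarith [sq_nonneg a]
    · exact absurd (congrArg _ (congrArg _ (Subsingleton.elim i j))) hij

/-- The modular group is the free product of `ℤ/2` and `ℤ/3`. -/
noncomputable def equivCoprod :
    Monoid.CoprodI (FPfactor (Fin 0) (Fin 1) (Fin 1)) ≃* PSL2Z :=
  MulEquiv.ofBijective ofCoprod ⟨ofCoprod_injective, ofCoprod_surjective⟩

lemma hom_ext {G : Type*} [Group G] {f g : PSL2Z →* G} (hS : f S = g S) (hU : f U = g U) :
    f = g :=
  MonoidHom.eq_of_eqOn_dense closure_S_U <| by
    rintro _ (rfl | rfl)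
    exacts [hS, hU]

lemma exists_hom {G : Type*} [Group G] {a b : G} (ha : a ^ 2 = 1) (hb : b ^ 3 = 1) :
    ∃ f : PSL2Z →* G, f S = a ∧ f U = b := by
  let f := (coprodFPfactorHomEquiv (Fin 0) (Fin 1) (Fin 1) G).symm
    ⟨Fin.elim0, fun _ ↦ ⟨a, ha⟩, fun _ ↦ ⟨b, hb⟩⟩
  have h₂ : f (Monoid.CoprodI.of (i := Sum.inr (Sum.inl 0))
      (Multiplicative.ofAdd (1 : ZMod 2))) = a :=
    (Monoid.CoprodI.lift_of _ _).trans <|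
      (zmodHomEquiv_symm_apply 2 G ⟨a, ha⟩ _).trans (pow_one _)
  have h₃ : f (Monoid.CoprodI.of (i := Sum.inr (Sum.inr 0))
      (Multiplicative.ofAdd (1 : ZMod 3))) = b :=
    (Monoid.CoprodI.lift_of _ _).trans <|
      (zmodHomEquiv_symm_apply 3 G ⟨b, hb⟩ _).trans (pow_one _)
  refine ⟨f.comp equivCoprod.symm.toMonoidHom, ?_, ?_⟩
  · rw [← h₂]
    refine congrArg f ((MulEquiv.symm_apply_eq _).mpr ?_)
    exact ((ofCoprod_apply_two 0 _).trans (pow_one _)).symm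
  · rw [← h₃]
    refine congrArg f ((MulEquiv.symm_apply_eq _).mpr ?_)
    exact ((ofCoprod_apply_three 0 _).trans (pow_one _)).symm

end PSL2Z

section PrimeOrderPerm

variable {X : Type*} {p : ℕ} {σ : Equiv.Perm X}

lemma Equiv.Perm.SameCycle.exists_pow_lt_of_pow_eq_one (hp : p ≠ 0) (hσ : σ ^ p = 1) {x y : X}
    (h : σ.SameCycle x y) : ∃ i < p, (σ ^ i) x = y := by
  obtain ⟨i, rfl⟩ := h
  have h0 : 0 ≤ i % (p : ℤ) := Int.emod_nonneg _ (by exact_mod_cast hp)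
  have h1 : i % (p : ℤ) < p := Int.emod_lt_of_pos _ (by omega)
  refine ⟨(i % p).toNat, by omega, ?_⟩
  rw [zpow_eq_zpow_emod' i hσ, ← zpow_natCast, Int.toNat_of_nonneg h0]

lemma Equiv.Perm.prod_range_pow_apply {K : Type*} [CommGroup K] (hσ : σ ^ p = 1) (n : X → K)
    (x : X) (j : ℕ) :
    ∏ i ∈ Finset.range p, n ((σ ^ i) ((σ ^ j) x)) = ∏ i ∈ Finset.range p, n ((σ ^ i) x) := by
  induction j with
  | zero => simp
  | succ j ih =>
    rw [← ih]
    have h := (Finset.prod_range_succ' (fun i ↦ n ((σ ^ i) ((σ ^ j) x))) p).symm.trans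
      (Finset.prod_range_succ _ p)
    simp only [pow_zero, hσ, Equiv.Perm.one_apply] at h
    rw [← mul_right_cancel h]
    refine Finset.prod_congr rfl fun i _ ↦ ?_
    rw [pow_succ' σ j, pow_succ σ i]
    rfl

end PrimeOrderPerm

lemma card_prod_eq_one (p : ℕ) (K : Type*) [CommGroup K] :
    Nat.card {f : Fin (p + 1) → K // ∏ i, f i = 1} = Nat.card K ^ p := by
  rw [← Nat.card_fin p, ← Nat.card_fun, Nat.card_fin]
  refine Nat.card_congr
    { toFun := fun f i ↦ f.1 i.succ
      invFun := fun f ↦ ⟨Fin.cons (∏ i, f i)⁻¹ f, by simp [Fin.prod_univ_succ]⟩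
      left_inv := fun f ↦ Subtype.ext <| funext <| Fin.cases ?_ fun i ↦ by simp
      right_inv := fun f ↦ by simp }
  have := f.2
  rw [Fin.prod_univ_succ] at this
  simpa using (eq_inv_of_mul_eq_one_left this).symm

namespace Equiv.Perm

variable {X : Type*} {p : ℕ} (σ : Equiv.Perm X)

/-- The nontrivial cycles of a permutation. -/
abbrev MovedCycle : Type _ :=
  {q : Quotient (SameCycle.setoid σ) // ¬ σ q.out = q.out}

/-- The trivial cycles of a permutation. -/
abbrev FixedCycle : Type _ :=
  {q : Quotient (SameCycle.setoid σ) // σ q.out = q.out}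

/-- Points of the underlying set, listed along the cycles. -/
noncomputable def cyclePoint (p : ℕ) : σ.MovedCycle × Fin p ⊕ σ.FixedCycle → X :=
  Sum.elim (fun y ↦ (σ ^ (y.2 : ℕ)) y.1.1.out) fun q ↦ q.1.out

variable {σ}

lemma pow_apply_out_inj {q q' : Quotient (SameCycle.setoid σ)} {i j : ℕ}
    (h : (σ ^ i) q.out = (σ ^ j) q'.out) : q = q' := by
  rw [← Quotient.out_equiv_out]
  change σ.SameCycle _ _
  rw [← sameCycle_pow_left (n := i), h, sameCycle_pow_left]

lemma cyclePoint_bijective (hp : p.Prime) (hσ : σ ^ p = 1) :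
    Function.Bijective (σ.cyclePoint p) := by
  constructor
  · rintro (⟨q, i⟩ | q) (⟨q', j⟩ | q') h
    · have hq : q = q' := Subtype.ext (pow_apply_out_inj h)
      subst hq
      have : Fact p.Prime := ⟨hp⟩
      have hmin : Function.minimalPeriod σ q.1.out = p :=
        Function.minimalPeriod_eq_prime
          (by rw [Function.IsPeriodicPt, iterate_eq_pow, hσ]; rfl) q.2
      have hij : (i : ℕ) = j := by
        refine (Function.iterate_eq_iterate_iff_of_lt_minimalPeriod (f := σ) (x := q.1.out)
          (by rw [hmin]; exact i.2) (by rw [hmin]; exact j.2)).mp ?_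
        rw [iterate_eq_pow, iterate_eq_pow]
        exact h
      rw [Fin.ext hij]
    · have hq : q.1 = q'.1 := pow_apply_out_inj (j := 0) h
      exact absurd q'.2 (hq ▸ q.2)
    · have hq : q.1 = q'.1 := pow_apply_out_inj (i := 0) h
      exact absurd q.2 (hq ▸ q'.2)
    · rw [Subtype.ext (pow_apply_out_inj (i := 0) (j := 0) h)]
  · intro x
    have hx : σ.SameCycle (Quotient.mk (SameCycle.setoid σ) x).out x :=
      Quotient.mk_out (s := SameCycle.setoid σ) x
    by_cases hq : σ (Quotient.mk (SameCycle.setoid σ) x).out =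
        (Quotient.mk (SameCycle.setoid σ) x).out
    · refine ⟨Sum.inr ⟨_, hq⟩, ?_⟩
      obtain ⟨i, hi⟩ := hx
      exact (zpow_apply_eq_self_of_apply_eq_self hq i).symm.trans hi
    · obtain ⟨i, hi, h⟩ := hx.exists_pow_lt_of_pow_eq_one hp.ne_zero hσ
      exact ⟨Sum.inl ⟨⟨_, hq⟩, ⟨i, hi⟩⟩, h⟩

lemma forall_prod_range_pow_eq_one_iff (hp : p.Prime) (hσ : σ ^ p = 1) {K : Type*} [CommGroup K]
    (n : X → K) :
    (∀ x, ∏ i ∈ Finset.range p, n ((σ ^ i) x) = 1) ↔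
      (∀ q : σ.MovedCycle, ∏ i : Fin p, n (σ.cyclePoint p (Sum.inl (q, i))) = 1) ∧
        ∀ q : σ.FixedCycle, n (σ.cyclePoint p (Sum.inr q)) ^ p = 1 := by
  have hfix (x : X) (hx : σ x = x) : ∏ i ∈ Finset.range p, n ((σ ^ i) x) = n x ^ p := by
    simp [pow_apply_eq_self_of_apply_eq_self hx]
  constructor
  · refine fun h ↦ ⟨fun q ↦ ?_, fun q ↦ ?_⟩
    · rw [← h q.1.out, Finset.prod_range]
      rfl
    · rw [← h q.1.out, hfix _ q.2]
      rfl
  · rintro ⟨h₁, h₂⟩ x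
    obtain ⟨⟨q, j⟩ | q, rfl⟩ := (cyclePoint_bijective hp hσ).2 x
    · refine (prod_range_pow_apply hσ n q.1.out j).trans ?_
      rw [Finset.prod_range]
      exact h₁ q
    · exact (hfix _ q.2).trans (h₂ q)

/-- Functions whose product along every `p`-periodic orbit is trivial. -/
noncomputable def prodRangePowEquiv (hp : p.Prime) (hσ : σ ^ p = 1) (K : Type*) [CommGroup K] :
    {n : X → K // ∀ x, ∏ i ∈ Finset.range p, n ((σ ^ i) x) = 1} ≃
      (σ.MovedCycle → {f : Fin p → K // ∏ i, f i = 1}) × (σ.FixedCycle → {k : K // k ^ p = 1}) :=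
  (Equiv.subtypeEquiv
      (((Equiv.ofBijective _ (cyclePoint_bijective hp hσ)).arrowCongr (Equiv.refl K)).symm.trans <|
        (Equiv.sumArrowEquivProdArrow _ _ K).trans <|
          Equiv.prodCongr (Equiv.curry _ _ _) (Equiv.refl _))
      (q := fun f ↦ (∀ q, ∏ i, f.1 q i = 1) ∧ ∀ q, f.2 q ^ p = 1)
      (forall_prod_range_pow_eq_one_iff hp hσ)).trans <|
    (Equiv.subtypeProdEquivProd (p := fun f : σ.MovedCycle → Fin p → K ↦ ∀ q, ∏ i, f q i = 1)
      (q := fun f : σ.FixedCycle → K ↦ ∀ q, f q ^ p = 1)).trans <|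
      Equiv.prodCongr (Equiv.subtypePiEquivPi (p := fun _ (f : Fin p → K) ↦ ∏ i, f i = 1))
        (Equiv.subtypePiEquivPi (p := fun _ (k : K) ↦ k ^ p = 1))

lemma card_eq_of_prime_pow_eq_one [Finite X] (hp : p.Prime) (hσ : σ ^ p = 1) :
    Nat.card X = p * Nat.card σ.MovedCycle + Nat.card σ.FixedCycle := by
  rw [← Nat.card_congr (Equiv.ofBijective _ (cyclePoint_bijective hp hσ)), Nat.card_sum,
    Nat.card_prod, Nat.card_fin, mul_comm]

lemma card_prod_range_pow_eq_one [Finite X] (hp : p.Prime) (hσ : σ ^ p = 1) (K : Type*)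
    [CommGroup K] :
    Nat.card {n : X → K // ∀ x, ∏ i ∈ Finset.range p, n ((σ ^ i) x) = 1} =
      (Nat.card K ^ (p - 1)) ^ Nat.card σ.MovedCycle *
        Nat.card {k : K // k ^ p = 1} ^ Nat.card σ.FixedCycle := by
  rw [Nat.card_congr (prodRangePowEquiv hp hσ K), Nat.card_prod, Nat.card_fun, Nat.card_fun]
  obtain ⟨r, rfl⟩ := Nat.exists_eq_add_of_lt hp.pos
  rw [zero_add, card_prod_eq_one, Nat.add_sub_cancel]

end Equiv.Perm

section CrossedHom

variable {G K : Type*} [Group G] [CommGroup K]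

variable (G K) in
/-- Crossed homomorphisms from `G` to the group of `K`-valued functions on a `G`-set `X`. -/
abbrev CrossedHom (X : Type*) [MulAction G X] : Type _ :=
  {n : G → X → K // ∀ g h x, n (g * h) x = n g x * n h (g⁻¹ • x)}

variable (H : Subgroup G)

lemma coset_out_smul (x : G ⧸ H) : x.out • ((1 : G) : G ⧸ H) = x := by
  rw [MulAction.Quotient.smul_coe, smul_eq_mul, mul_one, QuotientGroup.out_eq']

lemma coset_transition_mem (g : G) (x : G ⧸ H) : x.out⁻¹ * g * (g⁻¹ • x).out ∈ H := by
  rw [mul_assoc, ← QuotientGroup.eq]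
  simp [← smul_eq_mul, ← MulAction.Quotient.smul_coe]

lemma coset_one_out_mem : ((1 : G) : G ⧸ H).out ∈ H := by
  have h := QuotientGroup.out_eq' ((1 : G) : G ⧸ H)
  rw [eq_comm, QuotientGroup.eq] at h
  simpa using h

/-- The element of `H` comparing chosen representatives of a coset `x` and of `g⁻¹ • x`. -/
noncomputable def cosetTransition (g : G) (x : G ⧸ H) : H :=
  ⟨x.out⁻¹ * g * (g⁻¹ • x).out, coset_transition_mem H g x⟩

lemma cosetTransition_mul (g h : G) (x : G ⧸ H) :
    cosetTransition H (g * h) x = cosetTransition H g x * cosetTransition H h (g⁻¹ • x) := by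
  ext
  simp [cosetTransition, mul_assoc, mul_smul]

/-- A degree one form of Shapiro's lemma at the level of crossed homomorphisms. -/
noncomputable def crossedHomCosetEquiv :
    CrossedHom G K (G ⧸ H) × K ≃ (H →* K) × (G ⧸ H → K) where
  toFun n :=
    (MonoidHom.mk' (fun h ↦ n.1.1 h ((1 : G) : G ⧸ H)) fun a b ↦ by
      have : (a : G)⁻¹ • ((1 : G) : G ⧸ H) = ((1 : G) : G ⧸ H) := by
        rw [MulAction.Quotient.smul_coe, eq_comm, QuotientGroup.eq]
        simp
      simp [n.1.2, this],
    fun x ↦ n.1.1 x.out x * n.2)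
  invFun p :=
    (⟨fun g x ↦ p.2 x * p.1 (cosetTransition H g x) * (p.2 (g⁻¹ • x))⁻¹, fun g h x ↦ by
      simp only [cosetTransition_mul, map_mul, mul_inv_rev, mul_smul]
      group⟩,
    (p.1 ⟨_, coset_one_out_mem H⟩)⁻¹ * p.2 ((1 : G) : G ⧸ H))
  left_inv := by
    rintro ⟨⟨n, hn⟩, k⟩
    refine Prod.ext (Subtype.ext ?_) ?_
    · funext g x
      have h₁ := hn x.out (cosetTransition H g x) x
      have h₂ := hn g (g⁻¹ • x).out x
      have h₃ : x.out⁻¹ • x = ((1 : G) : G ⧸ H) :=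
        inv_smul_eq_iff.mpr (coset_out_smul H x).symm
      have h₄ : x.out * (cosetTransition H g x : G) = g * (g⁻¹ • x).out := by
        simp [cosetTransition, mul_assoc]
      rw [h₄, h₂, h₃] at h₁
      simp only [MonoidHom.mk'_apply]
      rw [mul_right_comm _ k, ← h₁]
      group
    · simp
  right_inv := by
    rintro ⟨φ, f⟩
    refine Prod.ext (MonoidHom.ext fun h ↦ ?_) ?_
    · have h₁ : (h : G)⁻¹ • ((1 : G) : G ⧸ H) = ((1 : G) : G ⧸ H) := by
        rw [MulAction.Quotient.smul_coe, eq_comm, QuotientGroup.eq]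
        simp
      have h₂ : cosetTransition H h ((1 : G) : G ⧸ H) =
          (⟨_, coset_one_out_mem H⟩ : H)⁻¹ * h * ⟨_, coset_one_out_mem H⟩ := by
        ext
        simp [cosetTransition, h₁]
      change f ((1 : G) : G ⧸ H) * φ (cosetTransition H h ((1 : G) : G ⧸ H)) *
        (f ((h : G)⁻¹ • ((1 : G) : G ⧸ H)))⁻¹ = φ h
      rw [h₁, h₂]
      simp [mul_comm]
    · funext x
      have h₁ : x.out⁻¹ • x = ((1 : G) : G ⧸ H) :=
        inv_smul_eq_iff.mpr (coset_out_smul H x).symm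
      have h₂ : cosetTransition H x.out x = ⟨_, coset_one_out_mem H⟩ := by
        ext
        simp [cosetTransition, h₁]
      simp [h₁, h₂, mul_assoc]

variable {X : Type*} [MulAction G X]

lemma SemidirectProduct.pow_right {N : Type*} [Group N] {φ : G →* MulAut N} (w : N ⋊[φ] G)
    (m : ℕ) : (w ^ m).right = w.right ^ m :=
  map_pow SemidirectProduct.rightHom w m

lemma SemidirectProduct.pow_left_mulAutArrow
    (w : (X → K) ⋊[mulAutArrow (G := G) (A := X) (M := K)] G) (m : ℕ) (x : X) :
    (w ^ m).left x = ∏ i ∈ Finset.range m, w.left ((MulAction.toPerm w.right⁻¹ ^ i) x) := by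
  induction m generalizing x with
  | zero => simp
  | succ m ih =>
    have h : (w * w ^ m).left x = w.left x * (w ^ m).left (w.right⁻¹ • x) := rfl
    rw [pow_succ', h, ih, Finset.prod_range_succ', mul_comm]
    rfl

/-- A crossed homomorphism as a homomorphism into a semidirect product. -/
def CrossedHom.toHom (n : CrossedHom G K X) :
    G →* (X → K) ⋊[mulAutArrow (G := G) (A := X) (M := K)] G :=
  MonoidHom.mk' (fun g ↦ ⟨n.1 g, g⟩) fun g h ↦
    SemidirectProduct.ext (funext fun x ↦ n.2 g h x) rfl

end CrossedHom

namespace PSL2Z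

variable {K X : Type*} [CommGroup K] [MulAction PSL2Z X]

lemma prod_range_eq_one (n : CrossedHom PSL2Z K X) {g : PSL2Z} {m : ℕ} (hg : g ^ m = 1) (x : X) :
    ∏ i ∈ Finset.range m, n.1 g ((MulAction.toPerm g⁻¹ ^ i) x) = 1 := by
  have h : n.toHom g ^ m = 1 := by rw [← map_pow, hg, map_one]
  exact (SemidirectProduct.pow_left_mulAutArrow (n.toHom g) m x).symm.trans
    (congrFun (congrArg SemidirectProduct.left h) x)

variable (K X) in
/-- The values of a crossed homomorphism on the generators `S` and `U`. -/
def evalGenerators (n : CrossedHom PSL2Z K X) :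
    {a : X → K // ∀ x, ∏ i ∈ Finset.range 2, a ((MulAction.toPerm S⁻¹ ^ i) x) = 1} ×
      {b : X → K // ∀ x, ∏ i ∈ Finset.range 3, b ((MulAction.toPerm U⁻¹ ^ i) x) = 1} :=
  (⟨n.1 S, prod_range_eq_one n S_sq⟩, ⟨n.1 U, prod_range_eq_one n U_pow_three⟩)

variable (K X) in
lemma evalGenerators_bijective : Function.Bijective (evalGenerators K X) := by
  constructor
  · intro n n' h
    have hS : n.1 S = n'.1 S := congrArg (fun y ↦ y.1.1) h
    have hU : n.1 U = n'.1 U := congrArg (fun y ↦ y.2.1) h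
    have hom : n.toHom = n'.toHom :=
      hom_ext (SemidirectProduct.ext hS rfl) (SemidirectProduct.ext hU rfl)
    exact Subtype.ext <| funext fun g ↦
      congrArg SemidirectProduct.left (DFunLike.congr_fun hom g)
  · rintro ⟨⟨a, ha⟩, ⟨b, hb⟩⟩
    let W := (X → K) ⋊[mulAutArrow (G := PSL2Z) (A := X) (M := K)] PSL2Z
    have ha' : (⟨a, S⟩ : W) ^ 2 = 1 := SemidirectProduct.ext
      (funext fun x ↦ (SemidirectProduct.pow_left_mulAutArrow _ _ x).trans (ha x))
      ((SemidirectProduct.pow_right _ _).trans S_sq)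
    have hb' : (⟨b, U⟩ : W) ^ 3 = 1 := SemidirectProduct.ext
      (funext fun x ↦ (SemidirectProduct.pow_left_mulAutArrow _ _ x).trans (hb x))
      ((SemidirectProduct.pow_right _ _).trans U_pow_three)
    obtain ⟨f, hfS, hfU⟩ := exists_hom ha' hb'
    have hright : SemidirectProduct.rightHom.comp f = MonoidHom.id PSL2Z :=
      hom_ext (congrArg SemidirectProduct.right hfS) (congrArg SemidirectProduct.right hfU)
    have hr (g : PSL2Z) : (f g).right = g := DFunLike.congr_fun hright g
    refine ⟨⟨fun g ↦ (f g).left, fun g h x ↦ ?_⟩, ?_⟩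
    · have : (f g * f h).left x = (f g).left x * (f h).left ((f g).right⁻¹ • x) := rfl
      change (f (g * h)).left x = (f g).left x * (f h).left (g⁻¹ • x)
      rw [map_mul, this, hr]
    · exact Prod.ext (Subtype.ext (congrArg SemidirectProduct.left hfS))
        (Subtype.ext (congrArg SemidirectProduct.left hfU))

/-- Counting homomorphisms from a finite index subgroup in terms of the cycles of the generators. -/
lemma exists_cycle_counts (H : Subgroup PSL2Z) (hfin : H.index ≠ 0) :
    ∃ m₂ e₂ m₃ e₃ : ℕ, H.index = 2 * m₂ + e₂ ∧ H.index = 3 * m₃ + e₃ ∧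
      ∀ (K : Type) [CommGroup K],
        Nat.card (H →* K) * Nat.card K ^ H.index =
          (Nat.card K ^ 1) ^ m₂ * Nat.card {k : K // k ^ 2 = 1} ^ e₂ *
            ((Nat.card K ^ 2) ^ m₃ * Nat.card {k : K // k ^ 3 = 1} ^ e₃) * Nat.card K := by
  have : H.FiniteIndex := ⟨hfin⟩
  have hS : (MulAction.toPerm S⁻¹ : Equiv.Perm (PSL2Z ⧸ H)) ^ 2 = 1 := by
    change MulAction.toPermHom PSL2Z (PSL2Z ⧸ H) S⁻¹ ^ 2 = 1
    rw [← map_pow, inv_pow, S_sq, inv_one, map_one]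
  have hU : (MulAction.toPerm U⁻¹ : Equiv.Perm (PSL2Z ⧸ H)) ^ 3 = 1 := by
    change MulAction.toPermHom PSL2Z (PSL2Z ⧸ H) U⁻¹ ^ 3 = 1
    rw [← map_pow, inv_pow, U_pow_three, inv_one, map_one]
  refine ⟨_, _, _, _, Equiv.Perm.card_eq_of_prime_pow_eq_one Nat.prime_two hS,
    Equiv.Perm.card_eq_of_prime_pow_eq_one Nat.prime_three hU, fun K _ ↦ ?_⟩
  have h₁ := Nat.card_congr (crossedHomCosetEquiv H (K := K))
  rw [Nat.card_prod, Nat.card_prod, Nat.card_fun] at h₁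
  have h₂ := Nat.card_congr (Equiv.ofBijective _ (evalGenerators_bijective K (PSL2Z ⧸ H)))
  rw [Nat.card_prod, Equiv.Perm.card_prod_range_pow_eq_one Nat.prime_two hS,
    Equiv.Perm.card_prod_range_pow_eq_one Nat.prime_three hU] at h₂
  rw [← h₂, h₁]
  rfl

end PSL2Z

theorem stmt_4 (H : Subgroup PSL2Z) (n₀ n₂ n₃ : ℕ) (hfin : H.index ≠ 0)
    (hiso : Nonempty (H ≃* Monoid.CoprodI (FPfactor (Fin n₀) (Fin n₂) (Fin n₃)))) :
    (H.index : ℤ) = 6 * n₀ + 3 * n₂ + 4 * n₃ - 6 := by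
  obtain ⟨e⟩ := hiso
  obtain ⟨m₂, e₂, m₃, e₃, h₂, h₃, h⟩ := PSL2Z.exists_cycle_counts H hfin
  simp only [Nat.card_congr (e.monoidHomCongrLeftEquiv), card_coprodFPfactor_hom] at h
  have k2 := h (Multiplicative (ZMod 2))
  have k3 := h (Multiplicative (ZMod 3))
  have k5 := h (Multiplicative (ZMod 5))
  have c22 : Nat.card {k : Multiplicative (ZMod 2) // k ^ 2 = 1} = 2 := by
    rw [Nat.card_eq_fintype_card]; decide
  have c23 : Nat.card {k : Multiplicative (ZMod 2) // k ^ 3 = 1} = 1 := by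
    rw [Nat.card_eq_fintype_card]; decide
  have c32 : Nat.card {k : Multiplicative (ZMod 3) // k ^ 2 = 1} = 1 := by
    rw [Nat.card_eq_fintype_card]; decide
  have c33 : Nat.card {k : Multiplicative (ZMod 3) // k ^ 3 = 1} = 3 := by
    rw [Nat.card_eq_fintype_card]; decide
  have c52 : Nat.card {k : Multiplicative (ZMod 5) // k ^ 2 = 1} = 1 := by
    rw [Nat.card_eq_fintype_card]; decide
  have c53 : Nat.card {k : Multiplicative (ZMod 5) // k ^ 3 = 1} = 1 := by
    rw [Nat.card_eq_fintype_card]; decide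
  have card (n : ℕ) : Nat.card (Multiplicative (ZMod n)) = n := Nat.card_zmod n
  rw [c22, c23, card] at k2
  rw [c32, c33, card] at k3
  rw [c52, c53, card] at k5
  simp only [one_pow, one_mul, mul_one, ← pow_mul, ← pow_add, ← pow_succ] at k2 k3 k5
  have l2 := Nat.pow_right_injective le_rfl k2
  have l3 := Nat.pow_right_injective (by norm_num) k3
  have l5 := Nat.pow_right_injective (by norm_num) k5
  omega
end

section
/- The triples (L^r; χ, q) associated to two strongly Hurwitz equivalent braid monodromy factorizations (valued in symplectic automorphisms of L) are isomorphic: there is an R-module isomorphism φ of L^r with q' = q∘φ and χ' = χ∘φ. In particular the transcendental lattice (the quotient of ker χ by the kernel of the induced form q) is invariant under weak Hurwitz equivalence. -/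
open Finset

/-- A single Hurwitz move on a braid monodromy factorization, recorded as a list
`(m₁, …, m_r)` of elements of `G`: `(…, m_i, m_{i+1}, …) ↦ (…, m_i⁻¹ m_{i+1} m_i, m_i, …)`. -/
inductive HurwitzMove {G : Type*} [Group G] : List G → List G → Prop
  | mk (l₁ l₂ : List G) (a b : G) :
      HurwitzMove (l₁ ++ a :: b :: l₂) (l₁ ++ (a⁻¹ * b * a) :: a :: l₂)

/-- Strong Hurwitz equivalence: the equivalence relation generated by Hurwitz moves
and their inverses. -/
def StrongEq {G : Type*} [Group G] : List G → List G → Prop :=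
  Relation.EqvGen HurwitzMove

/-- Weak Hurwitz equivalence: additionally allows global conjugation
`(m_i) ↦ (g⁻¹ m_i g)`. -/
def WeakEq {G : Type*} [Group G] : List G → List G → Prop :=
  Relation.EqvGen fun x y =>
    HurwitzMove x y ∨ ∃ g : G, y = x.map fun m => g⁻¹ * m * g

/-- `χ(⊕xᵢ) = Σᵢ (ρ(mᵢ) − 1)xᵢ` for a factorization `l = (m₁, …, m_r)`. -/
def chiL {R L G : Type*} [CommRing R] [AddCommGroup L] [Module R L] [Group G]
    (ρ : G →* (L ≃ₗ[R] L)) (l : List G) (x : Fin l.length → L) : L :=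
  ∑ i, (ρ (l.get i) (x i) - x i)

/-- `q(⊕xᵢ) = −Σᵢ xᵢ·ρ(mᵢ)xᵢ + Σ_{i<j} (ρ(mᵢ)−1)xᵢ·(ρ(mⱼ)−1)xⱼ`. -/
def qL {R L V G : Type*} [CommRing R] [AddCommGroup L] [Module R L]
    [AddCommGroup V] [Module R V] [Group G] (B : L →ₗ[R] L →ₗ[R] V)
    (ρ : G →* (L ≃ₗ[R] L)) (l : List G) (x : Fin l.length → L) : V :=
  -∑ i, B (x i) (ρ (l.get i) (x i)) +
    ∑ i, ∑ j ∈ Ioi i, B (ρ (l.get i) (x i) - x i) (ρ (l.get j) (x j) - x j)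

section HurwitzTriples

variable {R L V G : Type*} [CommRing R] [AddCommGroup L] [Module R L]
  [AddCommGroup V] [Module R V] [Group G]

lemma chiL_cons (ρ : G →* (L ≃ₗ[R] L)) (a : G) (l : List G) (x : Fin (a :: l).length → L) :
    chiL ρ (a :: l) x = (ρ a (x 0) - x 0) + chiL ρ l (fun i => x i.succ) :=
  Fin.sum_univ_succ _

lemma qL_cons (B : L →ₗ[R] L →ₗ[R] V) (ρ : G →* (L ≃ₗ[R] L)) (a : G) (l : List G)
    (x : Fin (a :: l).length → L) :
    qL B ρ (a :: l) x = -B (x 0) (ρ a (x 0)) +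
      B (ρ a (x 0) - x 0) (chiL ρ l (fun i => x i.succ)) + qL B ρ l (fun i => x i.succ) := by
  have h₁ := Fin.sum_univ_succ (n := l.length)
    (fun i => B (x i) (ρ ((a :: l).get i) (x i)))
  have h₂ := Fin.sum_univ_succ (n := l.length) (fun i => ∑ j ∈ Ioi i,
    B (ρ ((a :: l).get i) (x i) - x i) (ρ ((a :: l).get j) (x j) - x j))
  simp only [Fin.Ioi_zero_eq_map, Fin.Ioi_succ, sum_map] at h₂
  unfold qL chiL
  rw [map_sum]
  refine (congrArg₂ (fun u v => -u + v) h₁ h₂).trans ?_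
  simp only [Fin.coe_succEmb, List.get_cons_zero, List.get_cons_succ']
  abel

/-- The triples of `l₁` and `l₂` are isomorphic up to the action of `g` on the values of `χ`. -/
def TripleIso (B : L →ₗ[R] L →ₗ[R] V) (ρ : G →* (L ≃ₗ[R] L)) (g : G) (l₁ l₂ : List G) : Prop :=
  ∃ φ : (Fin l₂.length → L) ≃ₗ[R] (Fin l₁.length → L),
    (∀ x, qL B ρ l₂ x = qL B ρ l₁ (φ x)) ∧ ∀ x, chiL ρ l₂ x = ρ g (chiL ρ l₁ (φ x))

variable {B : L →ₗ[R] L →ₗ[R] V} {ρ : G →* (L ≃ₗ[R] L)}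

namespace TripleIso

lemma refl (l : List G) : TripleIso B ρ 1 l l :=
  ⟨LinearEquiv.refl R _, fun _ => rfl, fun _ => by simp⟩

lemma symm {g : G} {l₁ l₂ : List G} (h : TripleIso B ρ g l₁ l₂) : TripleIso B ρ g⁻¹ l₂ l₁ := by
  obtain ⟨φ, hq, hχ⟩ := h
  refine ⟨φ.symm, fun x => by simp [hq], fun x => ?_⟩
  rw [hχ, ← LinearEquiv.mul_apply, ← map_mul]
  simp

lemma trans {g h : G} {l₁ l₂ l₃ : List G} (h₁ : TripleIso B ρ g l₁ l₂)
    (h₂ : TripleIso B ρ h l₂ l₃) : TripleIso B ρ (h * g) l₁ l₃ := by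
  obtain ⟨φ, hq, hχ⟩ := h₁
  obtain ⟨ψ, hq', hχ'⟩ := h₂
  exact ⟨ψ.trans φ, fun x => by simp [hq', hq], fun x => by simp [hχ', hχ, map_mul]⟩

lemma cons (hiso : ∀ (g : G) (x y : L), B (ρ g x) (ρ g y) = B x y) {g : G} {l₁ l₂ : List G}
    (h : TripleIso B ρ g l₁ l₂) (a : G) :
    TripleIso B ρ g (a :: l₁) ((g * a * g⁻¹) :: l₂) := by
  obtain ⟨φ, hq, hχ⟩ := h
  let ψ := (Fin.consLinearEquiv R (fun _ : Fin (l₂.length + 1) => L)).symm ≪≫ₗ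
    ((ρ g).symm.prodCongr φ) ≪≫ₗ Fin.consLinearEquiv R (fun _ : Fin (l₁.length + 1) => L)
  have hψ₀ (x) : x 0 = ρ g (ψ x 0) := ((ρ g).apply_symm_apply (x 0)).symm
  have hψ (x) : φ (fun i => x i.succ) = fun i => ψ x (Fin.succ i) := rfl
  have hconj (y : L) : ρ (g * a * g⁻¹) (ρ g y) = ρ g (ρ a y) := by
    simp only [← LinearEquiv.mul_apply, ← map_mul, inv_mul_cancel_right]
  refine ⟨ψ, fun x => ?_, fun x => ?_⟩
  · rw [qL_cons, qL_cons, hq, hχ, hψ, hψ₀ x, hconj, hiso, ← map_sub, hiso]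
  · rw [chiL_cons, chiL_cons, hχ, hψ, hψ₀ x, hconj, ← map_sub, map_add]

end TripleIso

/-- The linear automorphism `(y₁, y₂) ↦ (y₂ - a⁻¹(b - 1)a y₁, a y₁)` underlying a Hurwitz move. -/
def hurwitzEquiv (a b : L ≃ₗ[R] L) : (L × L) ≃ₗ[R] (L × L) where
  toFun y := (y.2 - a.symm (b (a y.1) - a y.1), a y.1)
  invFun x := (a.symm x.2, x.1 + a.symm (b x.2 - x.2))
  map_add' y z := by
    ext
    · simp only [Prod.fst_add, Prod.snd_add, map_add, map_sub]
      abel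
    · simp
  map_smul' c y := by ext <;> simp [smul_sub]
  left_inv y := by ext <;> simp
  right_inv x := by ext <;> simp

lemma apply_swap_of_alternating (hskew : ∀ x : L, B x x = 0) (x y : L) : B x y = -B y x := by
  have h := hskew (x + y)
  simp only [map_add, LinearMap.add_apply, hskew, zero_add, add_zero] at h
  exact eq_neg_of_add_eq_zero_right h

lemma tripleIso_hurwitzMove_nil (hskew : ∀ x : L, B x x = 0)
    (hiso : ∀ (g : G) (x y : L), B (ρ g x) (ρ g y) = B x y) (l : List G) (a b : G) :
    TripleIso B ρ 1 (a :: b :: l) ((a⁻¹ * b * a) :: a :: l) := by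
  let e : (L × L × (Fin l.length → L)) ≃ₗ[R] (Fin (l.length + 2) → L) :=
    ((LinearEquiv.refl R L).prodCongr (Fin.consLinearEquiv R fun _ => L)) ≪≫ₗ
      Fin.consLinearEquiv R (fun _ : Fin (l.length + 2) => L)
  let h := (LinearEquiv.prodAssoc R L L (Fin l.length → L)).symm ≪≫ₗ
    ((hurwitzEquiv (ρ a) (ρ b)).prodCongr (LinearEquiv.refl R (Fin l.length → L))) ≪≫ₗ
    LinearEquiv.prodAssoc R L L (Fin l.length → L)
  let φ := e.symm ≪≫ₗ h ≪≫ₗ e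
  have hφ (y₁ y₂ : L) (z : Fin l.length → L) : φ (e (y₁, y₂, z)) =
      e (y₂ - (ρ a).symm (ρ b (ρ a y₁) - ρ a y₁), ρ a y₁, z) := by
    change e (h (e.symm (e _))) = _
    rw [e.symm_apply_apply]
    rfl
  have hχ (c d : G) (y₁ y₂ : L) (z : Fin l.length → L) : chiL ρ (c :: d :: l) (e (y₁, y₂, z)) =
      (ρ c y₁ - y₁) + ((ρ d y₂ - y₂) + chiL ρ l z) := by
    rw [chiL_cons, chiL_cons]; rfl
  have hq (c d : G) (y₁ y₂ : L) (z : Fin l.length → L) : qL B ρ (c :: d :: l) (e (y₁, y₂, z)) =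
      -B y₁ (ρ c y₁) + B (ρ c y₁ - y₁) ((ρ d y₂ - y₂) + chiL ρ l z) +
        (-B y₂ (ρ d y₂) + B (ρ d y₂ - y₂) (chiL ρ l z) + qL B ρ l z) := by
    rw [qL_cons, qL_cons, chiL_cons]; rfl
  have hconj (y : L) : ρ (a⁻¹ * b * a) y = (ρ a).symm (ρ b (ρ a y)) := by
    simp only [map_mul, map_inv, LinearEquiv.mul_apply]; rfl
  have hadj (x y : L) : B ((ρ a).symm x) y = B x (ρ a y) := by
    rw [← hiso a, LinearEquiv.apply_symm_apply]
  have hadj' (x y : L) : B x ((ρ a).symm y) = B (ρ a x) y := by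
    rw [← hiso a, LinearEquiv.apply_symm_apply]
  refine ⟨φ, fun x => ?_, fun x => ?_⟩ <;>
    obtain ⟨⟨y₁, y₂, z⟩, rfl⟩ := e.surjective x <;> rw [hφ]
  · rw [hq, hq, hconj]
    have hy : y₁ = (ρ a).symm (ρ a y₁) := by simp
    generalize hu : ρ a y₁ = u at *
    subst hy
    obtain ⟨w, hw⟩ : ∃ w, (ρ a).symm (ρ b u - u) = w := ⟨_, rfl⟩
    have hw' : ρ a w = ρ b u - u := by simp [← hw]
    have h₁ : B ((ρ a).symm u) ((ρ a).symm (ρ b u)) = B u (ρ b u) := by simp [hadj]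
    have h₂ : (ρ a).symm (ρ b u) - (ρ a).symm u = w := by rw [← hw, map_sub]
    have h₃ : B (ρ a y₂) (ρ a w) = -B w y₂ := by
      rw [hiso, apply_swap_of_alternating hskew]
    rw [h₁, h₂, hw, ← hw']
    simp only [map_sub, map_add, LinearMap.sub_apply, h₃, hskew]
    abel
  · rw [map_one, LinearEquiv.coe_one, id_eq, hχ, hχ, hconj]
    simp only [map_sub, LinearEquiv.apply_symm_apply]
    have hy : (ρ a).symm (ρ a y₁) = y₁ := by simp
    rw [hy]
    abel

lemma HurwitzMove.tripleIso (hskew : ∀ x : L, B x x = 0)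
    (hiso : ∀ (g : G) (x y : L), B (ρ g x) (ρ g y) = B x y) {l₁ l₂ : List G}
    (h : HurwitzMove l₁ l₂) : TripleIso B ρ 1 l₁ l₂ := by
  obtain ⟨l, l', a, b⟩ := h
  induction l with
  | nil => exact tripleIso_hurwitzMove_nil hskew hiso l' a b
  | cons c l ih => simpa using ih.cons hiso c

lemma tripleIso_map_conj (hiso : ∀ (g : G) (x y : L), B (ρ g x) (ρ g y) = B x y) (g : G)
    (l : List G) : TripleIso B ρ g⁻¹ l (l.map fun m => g⁻¹ * m * g) := by
  induction l with
  | nil => exact ⟨LinearEquiv.refl R _, fun _ => rfl, fun _ => (map_zero (ρ g⁻¹)).symm⟩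
  | cons a l ih => simpa using ih.cons hiso a

end HurwitzTriples

theorem stmt_14 {R L V G : Type*} [CommRing R] [AddCommGroup L] [Module R L]
    [AddCommGroup V] [Module R V] [Group G]
    (B : L →ₗ[R] L →ₗ[R] V) (hskew : ∀ x : L, B x x = 0)
    (ρ : G →* (L ≃ₗ[R] L))
    (hiso : ∀ (g : G) (x y : L), B (ρ g x) (ρ g y) = B x y) :
    -- strongly equivalent factorizations have isomorphic triples `(L^r; χ, q)` …
    (∀ l₁ l₂ : List G, StrongEq l₁ l₂ →
      ∃ φ : (Fin l₂.length → L) ≃ₗ[R] (Fin l₁.length → L),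
        (∀ x, qL B ρ l₂ x = qL B ρ l₁ (φ x)) ∧
        (∀ x, chiL ρ l₂ x = chiL ρ l₁ (φ x))) ∧
    -- … and weakly equivalent ones have weakly isomorphic triples; in particular
    -- the kernels of `χ` correspond, with `q` preserved, so the transcendental
    -- lattice `ker χ / (ker of the induced form)` is a weak equivalence invariant
    (∀ l₁ l₂ : List G, WeakEq l₁ l₂ →
      ∃ (g : G) (φ : (Fin l₂.length → L) ≃ₗ[R] (Fin l₁.length → L)),
        (∀ x, qL B ρ l₂ x = qL B ρ l₁ (φ x)) ∧
        (∀ x, chiL ρ l₂ x = ρ g (chiL ρ l₁ (φ x))) ∧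
        (∀ x, chiL ρ l₂ x = 0 ↔ chiL ρ l₁ (φ x) = 0)) := by
  have strong {l₁ l₂ : List G} (h : StrongEq l₁ l₂) : TripleIso B ρ 1 l₁ l₂ := by
    induction h with
    | rel _ _ h => exact h.tripleIso hskew hiso
    | refl l => exact .refl l
    | symm _ _ _ ih => simpa using ih.symm
    | trans _ _ _ _ _ ih₁ ih₂ => simpa using ih₁.trans ih₂
  have weak {l₁ l₂ : List G} (h : WeakEq l₁ l₂) : ∃ g, TripleIso B ρ g l₁ l₂ := by
    induction h with
    | rel l _ h =>
      rcases h with h | ⟨g, rfl⟩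
      · exact ⟨1, h.tripleIso hskew hiso⟩
      · exact ⟨g⁻¹, tripleIso_map_conj hiso g l⟩
    | refl l => exact ⟨1, .refl l⟩
    | symm _ _ _ ih => exact ih.elim fun g h => ⟨g⁻¹, h.symm⟩
    | trans _ _ _ _ _ ih₁ ih₂ =>
      obtain ⟨g, h₁⟩ := ih₁
      obtain ⟨g', h₂⟩ := ih₂
      exact ⟨g' * g, h₁.trans h₂⟩
  refine ⟨fun l₁ l₂ h => ?_, fun l₁ l₂ h => ?_⟩
  · obtain ⟨φ, hq, hχ⟩ := strong h
    exact ⟨φ, hq, fun x => by simpa using hχ x⟩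
  · obtain ⟨g, φ, hq, hχ⟩ := weak h
    exact ⟨g, φ, hq, hχ, fun x => by simp [hχ]⟩
end

section
/- Let T_i(k) be the number of isomorphism classes of admissible trees Ξ with k nodes satisfying |Aut Ξ| = i. Then T_i(k) = 0 for i > 3, T₂(k) = C(k/2) if k is even and 0 otherwise, T₃(k) = C((k−1)/3) if k ≡ 1 mod 3 and 0 otherwise, and Σ_{i=1}^{3} T_i(k)/i = C(k)/(k+2), where C denotes the Catalan numbers. -/
/-- A (finite) 3-regular ribbon graph together with connectedness: a 3-skeleton.
`E` is the set of ends of edges, `op` is a free involution (sending an end to the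
other end of the same edge) and `nx` is a free automorphism of order 3 (the next
end at the same vertex in the cyclic order). -/
structure ThreeSkeleton where
  E : Type
  fintypeE : Fintype E
  op : Equiv.Perm E
  nx : Equiv.Perm E
  op_free : ∀ e, op e ≠ e
  op_invol : ∀ e, op (op e) = e
  nx_free : ∀ e, nx e ≠ e
  nx_order : ∀ e, nx (nx (nx e)) = e
  connected : ∀ e e' : E,
    ∃ g ∈ Subgroup.closure ({op, nx} : Set (Equiv.Perm E)), g e = e'

/-- The permutation whose orbits are the faces (regions) of the ribbon graph. -/
def ThreeSkeleton.z (Sk : ThreeSkeleton) : Equiv.Perm Sk.E :=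
  Sk.op.trans Sk.nx.symm

/-- A pseudo-tree: a 3-skeleton obtained from an admissible plane tree by attaching
a loop at each leaf.  Combinatorially: all faces except exactly one are monogonal
(fixed points of `z`), and the Euler characteristic is that of the sphere, i.e.
with `|E| = 6n` there are `n + 1` monogonal faces, so `6·#fix(z) = |E| + 6`. -/
def IsPseudoTree (Sk : ThreeSkeleton) : Prop :=
  (∃ e₀ : Sk.E, Sk.z e₀ ≠ e₀ ∧ ∀ e : Sk.E, Sk.z e = e ∨ Sk.z.SameCycle e₀ e) ∧
  6 * Nat.card {e : Sk.E // Sk.z e = e} = Nat.card Sk.E + 6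

/-- The automorphism group of a ribbon graph: permutations of the set of edge ends
commuting with both `op` and `nx`. -/
def ribbonAut (Sk : ThreeSkeleton) : Subgroup (Equiv.Perm Sk.E) :=
  Subgroup.centralizer ({Sk.op, Sk.nx} : Set (Equiv.Perm Sk.E))

/-- A pseudo-tree with `2k+2` vertices (i.e. `6(k+1)` edge ends), corresponding to an
admissible tree with `k` nodes. -/
structure SizedPseudoTree (k : ℕ) where
  Sk : ThreeSkeleton
  isPT : IsPseudoTree Sk
  size : Nat.card Sk.E = 6 * (k + 1)

/-- Isomorphism of (sized) pseudo-trees. -/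
def SPTIso {k : ℕ} (A B : SizedPseudoTree k) : Prop :=
  ∃ f : A.Sk.E ≃ B.Sk.E,
    (∀ e, f (A.Sk.op e) = B.Sk.op (f e)) ∧
    (∀ e, f (A.Sk.nx e) = B.Sk.nx (f e))

/-- `T_i(k)`: the number of isomorphism classes of pseudo-trees with `2k+2` vertices
(equivalently, admissible trees with `k` nodes) whose automorphism group has
order `i`. -/
noncomputable def TNum (k i : ℕ) : ℕ :=
  Nat.card (Quot (fun A B : {S : SizedPseudoTree k // Nat.card (ribbonAut S.Sk) = i} =>
    SPTIso A.1 B.1))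

/-- The edge ends lying on the branch of a pseudo-tree that is cut off at an end `root` and whose
shape is the binary tree `t`: each vertex of the branch carries the ends `root`, `fst`, `snd` in
cyclic order, nodes have two sub-branches, and each leaf carries the loop joining `fst` to `snd`. -/
inductive BranchEnd : BinaryTree Unit → Type
  | root (t : BinaryTree Unit) : BranchEnd t
  | fst (t : BinaryTree Unit) : BranchEnd t
  | snd (t : BinaryTree Unit) : BranchEnd t
  | left {a : Unit} {l r : BinaryTree Unit} (x : BranchEnd l) : BranchEnd (.node a l r)
  | right {a : Unit} {l r : BinaryTree Unit} (x : BranchEnd r) : BranchEnd (.node a l r)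

namespace BranchEnd

variable {α β : Type*} {t : BinaryTree Unit}

/-- The next end at the same vertex. -/
def next : {t : BinaryTree Unit} → BranchEnd t → BranchEnd t
  | _, root t => fst t
  | _, fst t => snd t
  | _, snd t => root t
  | _, left x => left x.next
  | _, right x => right x.next

/-- The other end of the same edge, when the branch is embedded in `α` by `emb` and its root edge
ends at `out`. -/
def opp : {t : BinaryTree Unit} → (BranchEnd t → α) → α → BranchEnd t → α
  | _, _, out, root _ => out
  | .nil, emb, _, fst _ => emb (snd _)
  | .nil, emb, _, snd _ => emb (fst _)
  | .node _ l _, emb, _, fst _ => emb (left (root l))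
  | .node _ _ r, emb, _, snd _ => emb (right (root r))
  | _, emb, _, left x => opp (fun y => emb (left y)) (emb (fst _)) x
  | _, emb, _, right x => opp (fun y => emb (right y)) (emb (snd _)) x

/-- The loop ends that are followed by their own opposite end. -/
def IsLoop : {t : BinaryTree Unit} → BranchEnd t → Prop
  | _, root _ => False
  | .nil, fst _ => True
  | .node _ _ _, fst _ => False
  | _, snd _ => False
  | _, left x => x.IsLoop
  | _, right x => x.IsLoop

theorem next_next_next (x : BranchEnd t) : x.next.next.next = x := by
  induction x <;> simp_all [next]

theorem next_ne (x : BranchEnd t) : x.next ≠ x := by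
  induction x <;> simp_all [next]

theorem map_opp (F : α → β) (emb : BranchEnd t → α) (out : α) (x : BranchEnd t) :
    F (opp emb out x) = opp (fun y => F (emb y)) (F out) x := by
  induction x generalizing out with
  | root t => simp [opp]
  | fst t => cases t <;> simp [opp]
  | snd t => cases t <;> simp [opp]
  | left x ih => simp [opp, ih]
  | right x ih => simp [opp, ih]

theorem opp_opp (f : α → α) (emb : BranchEnd t → α) (out : α)
    (hf : ∀ y, f (emb y) = opp emb out y) (hout : f out = emb (root t)) (x : BranchEnd t) :
    f (opp emb out x) = emb x := by
  induction x generalizing out with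
  | root t => simpa [opp] using hout
  | fst t => cases t <;> simp [opp, hf]
  | snd t => cases t <;> simp [opp, hf]
  | left x ih =>
    exact ih (fun y => emb (left y)) (emb (fst _)) (fun y => by simp [hf, opp]) (by simp [hf, opp])
  | right x ih =>
    exact ih (fun y => emb (right y)) (emb (snd _)) (fun y => by simp [hf, opp]) (by simp [hf, opp])

theorem opp_ne (emb : BranchEnd t → α) (out : α) (hemb : emb.Injective)
    (hout : ∀ y, emb y ≠ out) (x : BranchEnd t) : opp emb out x ≠ emb x := by
  induction x generalizing out with
  | root t => simpa [opp] using (hout _).symm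
  | fst t => cases t <;> simp [opp, hemb.eq_iff]
  | snd t => cases t <;> simp [opp, hemb.eq_iff]
  | left x ih =>
    exact ih (fun y => emb (left y)) (emb (fst _)) (fun _ _ h => by simpa using hemb h)
      (fun y h => by simpa using hemb h)
  | right x ih =>
    exact ih (fun y => emb (right y)) (emb (snd _)) (fun _ _ h => by simpa using hemb h)
      (fun y h => by simpa using hemb h)

theorem opp_eq_next_iff (emb : BranchEnd t → α) (out : α) (hemb : emb.Injective)
    (hout : ∀ y, emb y ≠ out) (x : BranchEnd t) :
    opp emb out x = emb x.next ↔ x.IsLoop := by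
  induction x generalizing out with
  | root t => cases t <;> simpa [opp, IsLoop] using (hout _).symm
  | fst t => cases t <;> simp [opp, hemb.eq_iff, next, IsLoop]
  | snd t => cases t <;> simp [opp, hemb.eq_iff, next, IsLoop]
  | left x ih =>
    simpa [IsLoop, opp, next] using ih (fun y => emb (left y)) (emb (fst _))
      (fun _ _ h => by simpa using hemb h) (fun y h => by simpa using hemb h)
  | right x ih =>
    simpa [IsLoop, opp, next] using ih (fun y => emb (right y)) (emb (snd _))
      (fun _ _ h => by simpa using hemb h) (fun y h => by simpa using hemb h)

/-- The ends of a branch of shape `nil`. -/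
def nilEquiv : BranchEnd .nil ≃ Fin 3 where
  toFun
    | root _ => 0
    | fst _ => 1
    | snd _ => 2
  invFun
    | 0 => root _
    | 1 => fst _
    | 2 => snd _
  left_inv x := by cases x <;> rfl
  right_inv i := by fin_cases i <;> rfl

/-- The ends of a branch that starts with a node. -/
def nodeEquiv (a : Unit) (l r : BinaryTree Unit) :
    BranchEnd (.node a l r) ≃ Fin 3 ⊕ BranchEnd l ⊕ BranchEnd r where
  toFun
    | root _ => .inl 0
    | fst _ => .inl 1
    | snd _ => .inl 2
    | left x => .inr (.inl x)
    | right x => .inr (.inr x)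
  invFun
    | .inl 0 => root _
    | .inl 1 => fst _
    | .inl 2 => snd _
    | .inr (.inl x) => left x
    | .inr (.inr x) => right x
  left_inv x := by cases x <;> rfl
  right_inv i := by
    rcases i with i | i | i
    · fin_cases i <;> rfl
    · rfl
    · rfl

instance finite (t : BinaryTree Unit) : Finite (BranchEnd t) := by
  induction t with
  | nil => exact .of_equiv _ nilEquiv.symm
  | node a l r _ _ => exact .of_equiv _ (nodeEquiv a l r).symm

theorem card (t : BinaryTree Unit) : Nat.card (BranchEnd t) = 3 * (2 * t.numNodes + 1) := by
  induction t with
  | nil => simp [Nat.card_congr nilEquiv]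
  | node a l r hl hr =>
    simp [Nat.card_congr (nodeEquiv a l r), Nat.card_sum, hl, hr]
    ring

/-- The loops on a branch that starts with a node lie on its two sub-branches. -/
def loopNodeEquiv (a : Unit) (l r : BinaryTree Unit) :
    {x : BranchEnd (.node a l r) // x.IsLoop} ≃
      {x : BranchEnd l // x.IsLoop} ⊕ {x : BranchEnd r // x.IsLoop} where
  toFun
    | ⟨left x, h⟩ => .inl ⟨x, h⟩
    | ⟨right x, h⟩ => .inr ⟨x, h⟩
  invFun
    | .inl x => ⟨left x.1, x.2⟩
    | .inr x => ⟨right x.1, x.2⟩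
  left_inv x := by
    rcases x with ⟨x, h⟩
    cases x
    · exact h.elim
    · exact h.elim
    · exact h.elim
    · rfl
    · rfl
  right_inv x := by rcases x with x | x <;> rfl

theorem card_isLoop (t : BinaryTree Unit) :
    Nat.card {x : BranchEnd t // x.IsLoop} = t.numNodes + 1 := by
  induction t with
  | nil =>
    rw [BinaryTree.numNodes, Nat.card_eq_one_iff_unique]
    refine ⟨⟨?_⟩, ⟨⟨fst _, trivial⟩⟩⟩
    rintro ⟨x, hx⟩ ⟨y, hy⟩
    cases x <;> cases y <;> first | rfl | exact hx.elim | exact hy.elim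
  | node a l r hl hr =>
    simp [Nat.card_congr (loopNodeEquiv a l r), Nat.card_sum, hl, hr]
    ring

end BranchEnd

namespace ThreeSkeleton

open BranchEnd

/-- `S.IsBranch t e` says that cutting `S` at the end `e` leaves, on the side of `e`, a branch of
shape `t`. -/
def IsBranch (S : ThreeSkeleton) : BinaryTree Unit → S.E → Prop
  | .nil, e => S.op (S.nx e) = S.nx (S.nx e)
  | .node _ l r, e =>
    (S.op e ≠ S.nx e ∧ S.op (S.nx e) ≠ S.nx (S.nx e) ∧ S.op (S.nx (S.nx e)) ≠ e) ∧
      S.IsBranch l (S.op (S.nx e)) ∧ S.IsBranch r (S.op (S.nx (S.nx e)))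

/-- The ends of a branch with root end `e`. -/
def place (S : ThreeSkeleton) : {t : BinaryTree Unit} → S.E → BranchEnd t → S.E
  | _, e, root _ => e
  | _, e, fst _ => S.nx e
  | _, e, snd _ => S.nx (S.nx e)
  | _, e, left x => S.place (S.op (S.nx e)) x
  | _, e, right x => S.place (S.op (S.nx (S.nx e))) x

variable {S : ThreeSkeleton} {t u : BinaryTree Unit} {e e' : S.E}

attribute [simp] op_invol nx_order

theorem op_eq_iff : S.op e = e' ↔ e = S.op e' :=
  ⟨fun h => by rw [← h, S.op_invol], fun h => by rw [h, S.op_invol]⟩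

theorem nx_eq_iff : S.nx e = e' ↔ e = S.nx (S.nx e') :=
  ⟨fun h => by rw [← h, S.nx_order], fun h => by rw [h, S.nx_order]⟩

theorem nx_nx_ne (e : S.E) : S.nx (S.nx e) ≠ e := fun h =>
  S.nx_free e ((congrArg S.nx h).symm.trans (S.nx_order e))

theorem nx_symm_apply (e : S.E) : S.nx.symm e = S.nx (S.nx e) := by
  rw [Equiv.symm_apply_eq, S.nx_order]

theorem z_apply (e : S.E) : S.z e = S.nx (S.nx (S.op e)) := by
  simp [z, nx_symm_apply]

theorem z_eq_self_iff : S.z e = e ↔ S.op e = S.nx e := by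
  rw [z_apply, nx_eq_iff, nx_eq_iff, S.nx_order]

theorem nx_place (e : S.E) (x : BranchEnd t) : S.nx (S.place e x) = S.place e x.next := by
  induction x generalizing e <;> simp_all [place, next]

theorem op_place (h : S.IsBranch t e) (x : BranchEnd t) :
    S.op (S.place e x) = opp (S.place e) (S.op e) x := by
  induction x generalizing e with
  | root t => simp [place, opp]
  | fst t =>
    cases t with
    | nil => exact h
    | node a l r => simp [place, opp]
  | snd t =>
    cases t with
    | nil => exact op_eq_iff.2 h.symm
    | node a l r => simp [place, opp]
  | left x ih => simpa [place, opp] using ih h.2.1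
  | right x ih => simpa [place, opp] using ih h.2.2

theorem IsBranch.unique (ht : S.IsBranch t e) (hu : S.IsBranch u e) : t = u := by
  induction t generalizing u e with
  | nil =>
    cases u with
    | nil => rfl
    | node a l r => exact (hu.1.2.1 ht).elim
  | node a l r hl hr =>
    cases u with
    | nil => exact (ht.1.2.1 hu).elim
    | node a' l' r' => rw [hl ht.2.1 hu.2.1, hr ht.2.2 hu.2.2]

/-- The root end of a branch is not an end of a loop. -/
theorem IsBranch.op_ne_nx (h : S.IsBranch t e) : S.op e ≠ S.nx e := by
  cases t with
  | nil =>
    intro h'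
    exact nx_nx_ne e (h.symm.trans (op_eq_iff.1 h').symm)
  | node a l r => exact h.1.1

theorem IsBranch.op_nx_nx_ne (h : S.IsBranch t e) : S.op (S.nx (S.nx e)) ≠ e := by
  cases t with
  | nil =>
    intro h'
    rw [← h, S.op_invol] at h'
    exact S.nx_free e h'
  | node a l r => exact h.1.2.2

theorem mem_of_closed (S : ThreeSkeleton) (p : S.E → Prop) (hop : ∀ x, p x → p (S.op x))
    (hnx : ∀ x, p x → p (S.nx x)) {e : S.E} (h : p e) (x : S.E) : p x := by
  obtain ⟨g, hg, rfl⟩ := S.connected e x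
  have key : ∀ y, p y ↔ p (g y) := by
    induction hg using Subgroup.closure_induction with
    | mem g hg =>
      rcases hg with rfl | rfl
      · exact fun y => ⟨hop y, fun h => by simpa using hop _ h⟩
      · exact fun y => ⟨hnx y, fun h => by simpa using hnx _ (hnx _ h)⟩
    | one => simp
    | mul a b _ _ ha hb => exact fun y => by rw [hb, ha]; rfl
    | inv a _ ha => exact fun y => by simpa using (ha (a⁻¹ y)).symm
  exact (key e).1 h

/-- Two branches glued along their root edges. -/
def glueOp (l r : BinaryTree Unit) : BranchEnd l ⊕ BranchEnd r → BranchEnd l ⊕ BranchEnd r :=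
  Sum.elim (opp Sum.inl (.inr (root r))) (opp Sum.inr (.inl (root l)))

theorem glueOp_involutive (l r : BinaryTree Unit) : Function.Involutive (glueOp l r) := by
  rintro (x | x)
  · exact opp_opp (glueOp l r) _ _ (fun y => rfl) rfl x
  · exact opp_opp (glueOp l r) _ _ (fun y => rfl) rfl x

/-- The next end at the same vertex, as a permutation. -/
def glueNext (l r : BinaryTree Unit) : Equiv.Perm (BranchEnd l ⊕ BranchEnd r) where
  toFun := Sum.map next next
  invFun x := Sum.map next next (Sum.map next next x)
  left_inv := by rintro (x | x) <;> simp [next_next_next]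
  right_inv := by rintro (x | x) <;> simp [next_next_next]

theorem reachable_root {α : Type*} {H : Subgroup (Equiv.Perm α)} (emb : BranchEnd t → α) (out : α)
    (hop : ∀ x, ∃ g ∈ H, g (emb x) = opp emb out x)
    (hnx : ∀ x, ∃ g ∈ H, g (emb x) = emb x.next) (x : BranchEnd t) :
    ∃ g ∈ H, g (emb (root t)) = emb x := by
  have trans : ∀ {a b c : α}, (∃ g ∈ H, g a = b) → (∃ g ∈ H, g b = c) → ∃ g ∈ H, g a = c := by
    rintro a b c ⟨g, hg, rfl⟩ ⟨g', hg', rfl⟩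
    exact ⟨g' * g, H.mul_mem hg' hg, rfl⟩
  induction x generalizing out with
  | root t => exact ⟨1, H.one_mem, rfl⟩
  | fst t => exact hnx (root t)
  | snd t => exact trans (hnx (root t)) (hnx (fst t))
  | left x ih =>
    exact trans (hnx (root _)) <| trans (by simpa [opp, next] using hop (fst _)) <|
      ih (fun y => emb (left y)) (emb (fst _)) (fun y => hop (left y)) (fun y => hnx (left y))
  | right x ih =>
    exact trans (hnx (root _)) <| trans (hnx (fst _)) <|
      trans (by simpa [opp, next] using hop (snd _)) <|
      ih (fun y => emb (right y)) (emb (snd _)) (fun y => hop (right y)) (fun y => hnx (right y))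

/-- The skeleton obtained by gluing two branches along their root edges. -/
noncomputable def glue (l r : BinaryTree Unit) : ThreeSkeleton where
  E := BranchEnd l ⊕ BranchEnd r
  fintypeE := Fintype.ofFinite _
  op := (glueOp_involutive l r).toPerm
  nx := glueNext l r
  op_free := by
    rintro (x | x)
    · exact opp_ne _ _ Sum.inl_injective (fun y => by simp) x
    · exact opp_ne _ _ Sum.inr_injective (fun y => by simp) x
  op_invol := glueOp_involutive l r
  nx_free := by
    rintro (x | x)
    · exact fun h => next_ne x (Sum.inl_injective h)
    · exact fun h => next_ne x (Sum.inr_injective h)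
  nx_order := (glueNext l r).right_inv
  connected := by
    set op := (glueOp_involutive l r).toPerm with hop
    set H := Subgroup.closure {op, glueNext l r}
    have hopH : op ∈ H := Subgroup.subset_closure (by simp)
    have hnxH : glueNext l r ∈ H := Subgroup.subset_closure (by simp)
    have key : ∀ x, ∃ g ∈ H, g (.inl (root l)) = x := by
      rintro (x | x)
      · exact reachable_root Sum.inl _ (fun x => ⟨op, hopH, rfl⟩) (fun x => ⟨_, hnxH, rfl⟩) x
      · obtain ⟨g, hg, hx⟩ :=
          reachable_root Sum.inr _ (fun x => ⟨op, hopH, rfl⟩) (fun x => ⟨_, hnxH, rfl⟩) x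
        exact ⟨g * op, H.mul_mem hg hopH, hx⟩
    intro x y
    obtain ⟨g, hg, rfl⟩ := key x
    obtain ⟨g', hg', rfl⟩ := key y
    exact ⟨g' * g⁻¹, H.mul_mem hg' (H.inv_mem hg), by simp⟩

/-- The distinguished end of a glued skeleton. -/
noncomputable def glueRoot (l r : BinaryTree Unit) : (glue l r).E := .inl (root l)

theorem isBranch_of_embedding (emb : BranchEnd t → S.E) (out : S.E) (hemb : emb.Injective)
    (hout : ∀ y, emb y ≠ out) (hop : ∀ x, S.op (emb x) = opp emb out x)
    (hnx : ∀ x, S.nx (emb x) = emb x.next) : S.IsBranch t (emb (root t)) := by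
  induction t generalizing out with
  | nil => simp [IsBranch, hnx, next, hop, opp]
  | node a l r hl hr =>
    refine ⟨?_, ?_, ?_⟩
    · simpa [hnx, next, hop, opp, hemb.eq_iff] using (hout _).symm
    · simpa [hnx, next, hop, opp] using hl (fun y => emb (left y)) (emb (fst _))
        (fun _ _ h => by simpa using hemb h) (fun y h => by simpa using hemb h)
        (fun x => by simp [hop, opp]) (fun x => by simp [hnx, next])
    · simpa [hnx, next, hop, opp] using hr (fun y => emb (right y)) (emb (snd _))
        (fun _ _ h => by simpa using hemb h) (fun y h => by simpa using hemb h)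
        (fun x => by simp [hop, opp]) (fun x => by simp [hnx, next])

theorem isBranch_glueRoot (l r : BinaryTree Unit) : (glue l r).IsBranch l (glueRoot l r) :=
  isBranch_of_embedding (S := glue l r) Sum.inl (.inr (root r)) Sum.inl_injective
    (fun _ => Sum.inl_ne_inr) (fun _ => rfl) (fun _ => rfl)

theorem isBranch_op_glueRoot (l r : BinaryTree Unit) :
    (glue l r).IsBranch r ((glue l r).op (glueRoot l r)) :=
  isBranch_of_embedding (S := glue l r) Sum.inr (.inl (root l)) Sum.inr_injective
    (fun _ => Sum.inr_ne_inl) (fun _ => rfl) (fun _ => rfl)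

theorem card_glue (l r : BinaryTree Unit) :
    Nat.card (glue l r).E = 6 * (l.numNodes + r.numNodes + 1) := by
  change Nat.card (BranchEnd l ⊕ BranchEnd r) = _
  rw [Nat.card_sum, BranchEnd.card, BranchEnd.card]
  ring

theorem glue_z_inl_iff {l r : BinaryTree Unit} (x : BranchEnd l) :
    (glue l r).z (.inl x) = .inl x ↔ x.IsLoop :=
  z_eq_self_iff.trans <|
    opp_eq_next_iff Sum.inl (.inr (root r)) Sum.inl_injective (fun _ => Sum.inl_ne_inr) x

theorem glue_z_inr_iff {l r : BinaryTree Unit} (x : BranchEnd r) :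
    (glue l r).z (.inr x) = .inr x ↔ x.IsLoop :=
  z_eq_self_iff.trans <|
    opp_eq_next_iff Sum.inr (.inl (root l)) Sum.inr_injective (fun _ => Sum.inr_ne_inl) x

theorem card_fixed_glue (l r : BinaryTree Unit) :
    Nat.card {e : (glue l r).E // (glue l r).z e = e} = l.numNodes + r.numNodes + 2 := by
  have : Nat.card {e : BranchEnd l ⊕ BranchEnd r // (glue l r).z e = e} =
      Nat.card ({x : BranchEnd l // x.IsLoop} ⊕ {x : BranchEnd r // x.IsLoop}) :=
    Nat.card_congr <| Equiv.subtypeSum.trans <| Equiv.sumCongr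
      (Equiv.subtypeEquivRight glue_z_inl_iff) (Equiv.subtypeEquivRight glue_z_inr_iff)
  rw [Nat.card_sum, card_isLoop, card_isLoop] at this
  exact this.trans (by ring)

/-- All ends of a branch that are not fixed by `z` lie on one face. -/
theorem IsBranch.sameCycle (h : S.IsBranch t e) :
    S.z.SameCycle e (S.nx (S.nx e)) ∧
      ∀ x : BranchEnd t, S.z (S.place e x) = S.place e x ∨ S.z.SameCycle e (S.place e x) := by
  have step : ∀ y, S.z.SameCycle y (S.nx (S.nx (S.op y))) := fun y => by
    rw [← z_apply]
    exact Equiv.Perm.sameCycle_apply_right.2 (.refl _ _)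
  induction t generalizing e with
  | nil =>
    have hs : S.z.SameCycle e (S.nx (S.nx e)) := by
      have := step (S.nx (S.nx e))
      rw [← h, S.op_invol, h, S.nx_order] at this
      exact this.symm
    refine ⟨hs, fun x => ?_⟩
    cases x with
    | root => exact .inr (.refl _ _)
    | fst => exact .inl (z_eq_self_iff.2 h)
    | snd => exact .inr hs
  | node a l r hl hr =>
    obtain ⟨hl₁, hl₂⟩ := hl h.2.1
    obtain ⟨hr₁, hr₂⟩ := hr h.2.2
    have h₁ : S.z.SameCycle e (S.op (S.nx e)) := by
      simpa using (step (S.op (S.nx e))).symm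
    have h₂ : S.z.SameCycle e (S.nx e) := h₁.trans (hl₁.trans (step (S.nx e)).symm)
    have h₃ : S.z.SameCycle e (S.op (S.nx (S.nx e))) :=
      h₂.trans (by simpa using (step (S.op (S.nx (S.nx e)))).symm)
    have h₄ : S.z.SameCycle e (S.nx (S.nx e)) := h₃.trans (hr₁.trans (step (S.nx (S.nx e))).symm)
    refine ⟨h₄, fun x => ?_⟩
    cases x with
    | root => exact .inr (.refl _ _)
    | fst => exact .inr h₂
    | snd => exact .inr h₄
    | left x => exact (hl₂ x).imp_right h₁.trans
    | right x => exact (hr₂ x).imp_right h₃.trans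

/-- The map from the glued skeleton to any skeleton cut at an end. -/
def glueMap (S : ThreeSkeleton) (e : S.E) (l r : BinaryTree Unit) : (glue l r).E → S.E :=
  Sum.elim (S.place e) (S.place (S.op e))

variable {l r : BinaryTree Unit}

theorem glueMap_nx (S : ThreeSkeleton) (e : S.E) (l r : BinaryTree Unit) (x : (glue l r).E) :
    S.glueMap e l r ((glue l r).nx x) = S.nx (S.glueMap e l r x) := by
  rcases x with x | x
  · exact (nx_place e x).symm
  · exact (nx_place _ x).symm

theorem glueMap_op (hl : S.IsBranch l e) (hr : S.IsBranch r (S.op e)) (x : (glue l r).E) :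
    S.glueMap e l r ((glue l r).op x) = S.op (S.glueMap e l r x) := by
  rcases x with x | x
  · exact (map_opp (S.glueMap e l r) Sum.inl (.inr (root r)) x).trans (op_place hl x).symm
  · refine (map_opp (S.glueMap e l r) Sum.inr (.inl (root l)) x).trans ?_
    refine Eq.trans ?_ (op_place hr x).symm
    rw [S.op_invol]
    rfl

theorem glueMap_surjective (hl : S.IsBranch l e) (hr : S.IsBranch r (S.op e)) :
    (S.glueMap e l r).Surjective := by
  refine S.mem_of_closed (e := e) _ ?_ ?_ ⟨glueRoot l r, rfl⟩
  · rintro _ ⟨x, rfl⟩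
    exact ⟨_, glueMap_op hl hr x⟩
  · rintro _ ⟨x, rfl⟩
    exact ⟨_, glueMap_nx S e l r x⟩

/-- Cutting at an end puts every end on one of the two branches. -/
theorem exists_place (hl : S.IsBranch l e) (hr : S.IsBranch r (S.op e)) (x : S.E) :
    (∃ y : BranchEnd l, S.place e y = x) ∨ ∃ y : BranchEnd r, S.place (S.op e) y = x := by
  obtain ⟨y | y, rfl⟩ := glueMap_surjective hl hr x
  · exact .inl ⟨y, rfl⟩
  · exact .inr ⟨y, rfl⟩

theorem isPseudoTree_glue (l r : BinaryTree Unit) : IsPseudoTree (glue l r) := by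
  have hl := isBranch_glueRoot l r
  have hr := isBranch_op_glueRoot l r
  refine ⟨⟨glueRoot l r, fun h => hl.op_ne_nx (z_eq_self_iff.1 h), fun x => ?_⟩, ?_⟩
  · rcases exists_place hl hr x with ⟨y, rfl⟩ | ⟨y, rfl⟩
    · exact hl.sameCycle.2 y
    · refine (hr.sameCycle.2 y).imp_right fun h => ?_
      have := hr.sameCycle.1.symm
      rw [← z_apply, Equiv.Perm.sameCycle_apply_left] at this
      exact this.trans h
  · rw [card_fixed_glue, card_glue]
    ring

variable {S' S'' : ThreeSkeleton}

instance (S : ThreeSkeleton) : Finite S.E := @Finite.of_fintype _ S.fintypeE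

theorem IsBranch.isLoop_of_op_place (h : S.IsBranch t e) (x : BranchEnd t)
    (hx : S.op (S.place e x) = S.nx (S.place e x)) : x.IsLoop := by
  induction x generalizing e with
  | root t => exact (h.op_ne_nx hx).elim
  | fst t =>
    cases t with
    | nil => trivial
    | node a l r => exact (h.1.2.1 hx).elim
  | snd t => exact (h.op_nx_nx_ne (by simpa [place] using hx)).elim
  | left x ih => exact ih h.2.1 hx
  | right x ih => exact ih h.2.2 hx

theorem z_glueMap_iff (hl : S.IsBranch l e) (hr : S.IsBranch r (S.op e)) (x : (glue l r).E) :
    (glue l r).z x = x ↔ S.z (S.glueMap e l r x) = S.glueMap e l r x := by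
  refine ⟨fun h => ?_, fun h => ?_⟩
  · rw [z_eq_self_iff] at h ⊢
    rw [← glueMap_op hl hr, h, glueMap_nx]
  · rw [z_eq_self_iff] at h
    rcases x with x | x
    · exact (glue_z_inl_iff x).2 (hl.isLoop_of_op_place x h)
    · exact (glue_z_inr_iff x).2 (hr.isLoop_of_op_place x h)

theorem card_fiber_glueMap (hl : S.IsBranch l e) (hr : S.IsBranch r (S.op e)) (y : S.E) :
    Nat.card {x // S.glueMap e l r x = y} = Nat.card {x // S.glueMap e l r x = e} := by
  refine S.mem_of_closed (fun y => Nat.card {x // S.glueMap e l r x = y} = _) ?_ ?_ rfl y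
  · intro y hy
    rw [← hy]
    refine (Nat.card_congr ((glue l r).op.subtypeEquiv fun x => ?_)).symm
    rw [glueMap_op hl hr, EmbeddingLike.apply_eq_iff_eq]
  · intro y hy
    rw [← hy]
    refine (Nat.card_congr ((glue l r).nx.subtypeEquiv fun x => ?_)).symm
    rw [glueMap_nx, EmbeddingLike.apply_eq_iff_eq]

/-- The two branches at an end of a pseudo-tree glue back to the pseudo-tree: the map is a covering
and the Euler characteristic forces its degree to be one. -/
theorem glueMap_bijective (hS : IsPseudoTree S) (hl : S.IsBranch l e)
    (hr : S.IsBranch r (S.op e)) : (S.glueMap e l r).Bijective := by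
  refine ⟨?_, glueMap_surjective hl hr⟩
  set F := S.glueMap e l r
  set c := Nat.card {x // F x = e} with hc
  have hfib : ∀ y, Nat.card {x // F x = y} = c := card_fiber_glueMap hl hr
  have hE : Nat.card (glue l r).E = Nat.card S.E * c := by
    have := Fintype.ofFinite S.E
    rw [← Nat.card_congr (Equiv.sigmaFiberEquiv F), Nat.card_sigma]
    simp [hfib]
  have hfix : Nat.card {x // (glue l r).z x = x} = Nat.card {y // S.z y = y} * c := by
    have := Fintype.ofFinite {y // S.z y = y}
    rw [← Nat.card_congr (Equiv.sigmaSubtypeFiberEquivSubtype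
      (q := fun y => S.z y = y) F (z_glueMap_iff hl hr)),
      Nat.card_sigma]
    simp [hfib]
  rw [card_glue] at hE
  rw [card_fixed_glue] at hfix
  have hc1 : c = 1 := by
    have := congrArg (· * c) hS.2
    simp only [add_mul, mul_assoc, ← hfix, ← hE] at this
    omega
  intro x y hxy
  have := (Nat.card_eq_one_iff_unique.1 ((hfib (F y)).trans hc1)).1
  exact congrArg Subtype.val (this.elim ⟨x, hxy⟩ ⟨y, rfl⟩)

theorem numNodes_add_numNodes (hS : IsPseudoTree S) {k : ℕ} (hk : Nat.card S.E = 6 * (k + 1))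
    (hl : S.IsBranch l e) (hr : S.IsBranch r (S.op e)) : l.numNodes + r.numNodes = k := by
  have := Nat.card_eq_of_bijective _ (glueMap_bijective hS hl hr)
  rw [card_glue] at this
  omega

open Classical in
theorem exists_isBranch_nil (hS : IsPseudoTree S) :
    ∃ e, S.IsBranch .nil e ∧ ∃ t, S.IsBranch t (S.op e) := by
  by_contra! hcon
  have := Fintype.ofFinite S.E
  let a : S.E → ℕ := fun x => if ∃ t, S.IsBranch t x then 1 else 0
  let f : S.E → ℕ := fun x => if S.op x = S.nx x then 1 else 0
  have ha_le : ∀ x, a x ≤ 1 := fun x => by dsimp only [a]; split_ifs <;> simp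
  have ha_zero : ∀ x, (∀ t, ¬ S.IsBranch t x) → a x = 0 := fun x hx => by simpa [a] using hx
  have ha_one : ∀ {x t}, S.IsBranch t x → a x = 1 := fun {x t} hx => if_pos ⟨t, hx⟩
  have ha_node : ∀ x, S.op x ≠ S.nx x → S.op (S.nx x) ≠ S.nx (S.nx x) →
      S.op (S.nx (S.nx x)) ≠ x → a (S.op (S.nx x)) + a (S.op (S.nx (S.nx x))) ≤ a x + 1 := by
    intro x h₁ h₂ h₃
    have := ha_le (S.op (S.nx x))
    have := ha_le (S.op (S.nx (S.nx x)))
    by_cases hl : ∃ t, S.IsBranch t (S.op (S.nx x))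
    · by_cases hr : ∃ t, S.IsBranch t (S.op (S.nx (S.nx x)))
      · obtain ⟨l, hl⟩ := hl
        obtain ⟨r, hr⟩ := hr
        have : a x = 1 := ha_one (t := .node () l r) ⟨⟨h₁, h₂, h₃⟩, hl, hr⟩
        omega
      · have := ha_zero _ (not_exists.1 hr)
        omega
    · have := ha_zero _ (not_exists.1 hl)
      omega
  let p : S.E → Prop := fun x =>
    a (S.op x) + a (S.op (S.nx x)) + a (S.op (S.nx (S.nx x))) +
      2 * (f x + f (S.nx x) + f (S.nx (S.nx x))) ≤ a x + a (S.nx x) + a (S.nx (S.nx x)) + 1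
  have hleaf : ∀ x, S.op (S.nx x) = S.nx (S.nx x) → p x := by
    intro x hx
    have hx' : S.IsBranch .nil x := hx
    have h₁ : a x = 1 := ha_one hx'
    have h₂ : a (S.op x) = 0 := ha_zero _ (hcon x hx')
    have h₃ : a (S.nx x) = 0 := ha_zero _ fun t ht => ht.op_ne_nx hx
    have h₄ : a (S.nx (S.nx x)) = 0 := ha_zero _ fun t ht => ht.op_nx_nx_ne (by simpa using hx)
    have h₅ : f (S.nx x) = 1 := if_pos hx
    have h₆ : f x = 0 := if_neg hx'.op_ne_nx
    have h₇ : f (S.nx (S.nx x)) = 0 := if_neg (by simpa using hx'.op_nx_nx_ne)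
    have h₈ : S.op (S.nx (S.nx x)) = S.nx x := (op_eq_iff.1 hx).symm
    simp only [p, h₁, h₂, h₃, h₄, h₅, h₆, h₇, h₈, hx]
    omega
  have hp : ∀ x, p x := by
    intro x
    by_cases h₁ : S.op x = S.nx x
    · have := hleaf (S.nx (S.nx x)) (by simpa using h₁)
      simp only [p, S.nx_order] at this ⊢
      omega
    by_cases h₂ : S.op (S.nx x) = S.nx (S.nx x)
    · exact hleaf x h₂
    by_cases h₃ : S.op (S.nx (S.nx x)) = x
    · have := hleaf (S.nx x) (by simpa using h₃)
      simp only [p, S.nx_order] at this ⊢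
      omega
    have h₄ := ha_node x h₁ h₂ h₃
    have h₅ := ha_node (S.nx x) h₂ (by simpa using h₃) (by simpa using h₁)
    have h₆ := ha_node (S.nx (S.nx x)) (by simpa using h₃) (by simpa using h₁) (by simpa using h₂)
    have h₇ : f x = 0 := if_neg h₁
    have h₈ : f (S.nx x) = 0 := if_neg h₂
    have h₉ : f (S.nx (S.nx x)) = 0 := if_neg (by simpa using h₃)
    simp only [S.nx_order] at h₅ h₆
    have := ha_le (S.op x)
    have := ha_le (S.op (S.nx x))
    have := ha_le (S.op (S.nx (S.nx x)))
    simp only [p]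
    omega
  have hsum := Finset.sum_le_sum fun x (_ : x ∈ Finset.univ) => hp x
  have hnx : ∀ g : S.E → ℕ, ∑ x, g (S.nx x) = ∑ x, g x := fun g => Equiv.sum_comp S.nx g
  have hop : ∀ g : S.E → ℕ, ∑ x, g (S.op x) = ∑ x, g x := fun g => Equiv.sum_comp S.op g
  have hf : ∑ x, f x = Nat.card {x // S.z x = x} := by
    simp only [f, z_eq_self_iff]
    rw [Nat.card_eq_fintype_card, Fintype.card_subtype, Finset.card_filter]
  simp only [Finset.sum_add_distrib, ← Finset.mul_sum, hnx fun x => a (S.nx x), hnx a,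
    hnx fun x => f (S.nx x), hnx f, hnx fun x => a (S.op (S.nx x)), hnx fun x => a (S.op x), hop a,
    hf, Finset.sum_const, Finset.card_univ, smul_eq_mul, mul_one] at hsum
  have := hS.2
  rw [Nat.card_eq_fintype_card (α := S.E)] at this
  omega

theorem IsBranch.exists_isBranch_place (ht : S.IsBranch t e) (hu : S.IsBranch u (S.op e))
    (x : BranchEnd t) (h₁ : S.op (S.place e x) ≠ S.nx (S.place e x))
    (h₂ : S.op (S.nx (S.nx (S.place e x))) ≠ S.place e x) :
    ∃ a b, S.IsBranch a (S.place e x) ∧ S.IsBranch b (S.op (S.place e x)) := by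
  induction x generalizing e u with
  | root t => exact ⟨t, u, ht, hu⟩
  | fst t =>
    cases t with
    | nil => exact (h₁ ht).elim
    | node a l r =>
      refine ⟨.node () r u, l, ⟨⟨h₁, ?_, ?_⟩, ?_, ?_⟩, ht.2.1⟩ <;> simp only [place, S.nx_order]
      · exact ht.1.2.2
      · exact ht.1.1
      · exact ht.2.2
      · exact hu
  | snd t =>
    cases t with
    | nil =>
      have : S.op (S.nx e) = S.nx (S.nx e) := ht
      exact (h₂ (by simpa [place] using this)).elim
    | node a l r =>
      refine ⟨.node () u l, r, ⟨⟨h₁, ?_, ?_⟩, ?_, ?_⟩, ht.2.2⟩ <;> simp only [place, S.nx_order]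
      · exact ht.1.1
      · exact ht.1.2.1
      · exact hu
      · exact ht.2.1
  | left x ih =>
    rename_i a l r
    refine ih ht.2.1 (u := .node () r u) ?_ h₁ h₂
    refine ⟨⟨?_, ?_, ?_⟩, ?_, ?_⟩ <;> simp only [S.nx_order, S.op_invol]
    · exact ht.1.2.1
    · exact ht.1.2.2
    · exact ht.1.1
    · exact ht.2.2
    · exact hu
  | right x ih =>
    rename_i a l r
    refine ih ht.2.2 (u := .node () u l) ?_ h₁ h₂
    refine ⟨⟨?_, ?_, ?_⟩, ?_, ?_⟩ <;> simp only [S.nx_order, S.op_invol]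
    · exact ht.1.2.2
    · exact ht.1.1
    · exact ht.1.2.1
    · exact hu
    · exact ht.2.1

/-- Every end of a pseudo-tree that is not an end of a loop cuts it into two branches. -/
theorem exists_isBranch (hS : IsPseudoTree S) (x : S.E) (h₁ : S.op x ≠ S.nx x)
    (h₂ : S.op (S.nx (S.nx x)) ≠ x) : ∃ l r, S.IsBranch l x ∧ S.IsBranch r (S.op x) := by
  obtain ⟨e, he, t, ht⟩ := exists_isBranch_nil hS
  rcases exists_place he ht x with ⟨y, rfl⟩ | ⟨y, rfl⟩
  · exact he.exists_isBranch_place ht y h₁ h₂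
  · exact ht.exists_isBranch_place (by rwa [S.op_invol]) y h₁ h₂

/-- Every vertex of a branch has an end whose own branch points away from the root. -/
theorem IsBranch.exists_facing (ht : S.IsBranch t e) (x : BranchEnd t) :
    ∃ y s, (y = S.place e x ∨ y = S.nx (S.place e x) ∨ y = S.nx (S.nx (S.place e x))) ∧
      S.IsBranch s y ∧ (y = e ∨ s.numNodes < t.numNodes) := by
  induction x generalizing e with
  | root t => exact ⟨e, t, .inl rfl, ht, .inl rfl⟩
  | fst t => exact ⟨e, t, .inr (.inr (by simp [place])), ht, .inl rfl⟩
  | snd t => exact ⟨e, t, .inr (.inl (by simp [place])), ht, .inl rfl⟩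
  | left x ih =>
    obtain ⟨y, s, hy, hs, h⟩ := ih ht.2.1
    refine ⟨y, s, hy, hs, .inr ?_⟩
    rcases h with rfl | h
    · rw [hs.unique ht.2.1, BinaryTree.numNodes]
      omega
    · rw [BinaryTree.numNodes]
      omega
  | right x ih =>
    obtain ⟨y, s, hy, hs, h⟩ := ih ht.2.2
    refine ⟨y, s, hy, hs, .inr ?_⟩
    rcases h with rfl | h
    · rw [hs.unique ht.2.2, BinaryTree.numNodes]
      omega
    · rw [BinaryTree.numNodes]
      omega

/-- Isomorphisms of skeleta. -/
def IsIso (f : S.E ≃ S'.E) : Prop :=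
  (∀ e, f (S.op e) = S'.op (f e)) ∧ ∀ e, f (S.nx e) = S'.nx (f e)

theorem IsIso.symm {f : S.E ≃ S'.E} (hf : IsIso f) : IsIso f.symm :=
  ⟨fun e => by rw [Equiv.symm_apply_eq, hf.1, Equiv.apply_symm_apply],
    fun e => by rw [Equiv.symm_apply_eq, hf.2, Equiv.apply_symm_apply]⟩

theorem IsIso.trans {f : S.E ≃ S'.E} {g : S'.E ≃ S''.E} (hf : IsIso f) (hg : IsIso g) :
    IsIso (f.trans g) :=
  ⟨fun e => by simp [hf.1, hg.1], fun e => by simp [hf.2, hg.2]⟩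

theorem IsIso.isBranch {f : S.E ≃ S'.E} (hf : IsIso f) (h : S.IsBranch t e) :
    S'.IsBranch t (f e) := by
  induction t generalizing e with
  | nil =>
    change S'.op (S'.nx (f e)) = S'.nx (S'.nx (f e))
    rw [← hf.2, ← hf.1, ← hf.2]
    exact congrArg f h
  | node a l r hl hr =>
    refine ⟨⟨?_, ?_, ?_⟩, ?_, ?_⟩ <;> simp only [← hf.1, ← hf.2, ne_eq, f.apply_eq_iff_eq]
    · exact h.1.1
    · exact h.1.2.1
    · exact h.1.2.2
    · exact hl h.2.1
    · exact hr h.2.2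

theorem exists_isIso_glue (hS : IsPseudoTree S) (hl : S.IsBranch l e)
    (hr : S.IsBranch r (S.op e)) : ∃ f : (glue l r).E ≃ S.E, IsIso f ∧ f (glueRoot l r) = e :=
  ⟨.ofBijective _ (glueMap_bijective hS hl hr), ⟨glueMap_op hl hr, glueMap_nx S e l r⟩, rfl⟩

theorem exists_isIso (hS : IsPseudoTree S) (hS' : IsPseudoTree S') {e' : S'.E}
    (hl : S.IsBranch l e) (hr : S.IsBranch r (S.op e)) (hl' : S'.IsBranch l e')
    (hr' : S'.IsBranch r (S'.op e')) : ∃ f : S.E ≃ S'.E, IsIso f ∧ f e = e' := by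
  obtain ⟨f, hf, hfe⟩ := exists_isIso_glue hS hl hr
  obtain ⟨g, hg, hge⟩ := exists_isIso_glue hS' hl' hr'
  exact ⟨f.symm.trans g, hf.symm.trans hg, by simp [← hfe, hge]⟩

theorem mem_ribbonAut_iff {g : Equiv.Perm S.E} : g ∈ ribbonAut S ↔ IsIso g := by
  rw [ribbonAut, Subgroup.mem_centralizer_iff]
  refine ⟨fun h => ⟨fun e => (DFunLike.congr_fun (h _ (.inl rfl)) e).symm,
    fun e => (DFunLike.congr_fun (h _ (.inr rfl)) e).symm⟩, ?_⟩
  rintro ⟨h₁, h₂⟩ _ (rfl | rfl)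
  · exact Equiv.ext fun e => (h₁ e).symm
  · exact Equiv.ext fun e => (h₂ e).symm

theorem IsIso.eq_of_apply_eq {f g : S.E ≃ S'.E} (hf : IsIso f) (hg : IsIso g)
    (h : f e = g e) : f = g :=
  Equiv.ext <| S.mem_of_closed (fun x => f x = g x) (fun x hx => by rw [hf.1, hg.1, hx])
    (fun x hx => by rw [hf.2, hg.2, hx]) h

variable {a b c : BinaryTree Unit} {x : S.E} {k : ℕ}

theorem IsBranch.place_eq_of_balanced (ht : S.IsBranch t e) (x : BranchEnd t)
    (ha : S.IsBranch a (S.place e x)) (hb : S.IsBranch b (S.op (S.place e x)))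
    (hat : a.numNodes = t.numNodes) (hbt : b.numNodes = t.numNodes) : S.place e x = e := by
  obtain ⟨y, s, hy, hs, h⟩ := ht.exists_facing x
  have hst : s.numNodes ≤ t.numNodes := by
    rcases h with rfl | h
    · rw [hs.unique ht]
    · exact h.le
  rcases hy with rfl | rfl | rfl
  · refine h.resolve_right fun h => ?_
    rw [hs.unique ha] at h
    omega
  · cases s with
    | nil => exact (ha.op_nx_nx_ne (by simpa using show S.op _ = _ from hs)).elim
    | node _ l r =>
      have := hs.2.2
      rw [S.nx_order] at this
      rw [BinaryTree.numNodes, this.unique hb] at hst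
      omega
  · cases s with
    | nil => exact (ha.op_ne_nx (by simpa using show S.op _ = _ from hs)).elim
    | node _ l r =>
      have := hs.2.1
      rw [S.nx_order] at this
      rw [BinaryTree.numNodes, this.unique hb] at hst
      omega

/-- An edge that cuts a pseudo-tree into branches of equal size is unique. -/
theorem eq_or_eq_op_of_balanced (hS : IsPseudoTree S) (hk : Nat.card S.E = 6 * (k + 1))
    (hl : S.IsBranch l e) (hr : S.IsBranch r (S.op e)) (hlr : l.numNodes = r.numNodes)
    (ha : S.IsBranch a x) (hb : S.IsBranch b (S.op x)) (hab : a.numNodes = b.numNodes) :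
    x = e ∨ x = S.op e := by
  have h₁ := numNodes_add_numNodes hS hk hl hr
  have h₂ := numNodes_add_numNodes hS hk ha hb
  rcases exists_place hl hr x with ⟨y, rfl⟩ | ⟨y, rfl⟩
  · exact .inl (hl.place_eq_of_balanced y ha hb (by omega) (by omega))
  · exact .inr (hr.place_eq_of_balanced y ha hb (by omega) (by omega))

/-- All branches at the vertex of `e` have fewer than `k / 2` nodes. -/
def IsCenter (S : ThreeSkeleton) (k : ℕ) (e : S.E) : Prop :=
  (∃ a, S.IsBranch a (S.op e) ∧ 2 * a.numNodes < k) ∧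
    (∃ b, S.IsBranch b (S.op (S.nx e)) ∧ 2 * b.numNodes < k) ∧
    ∃ c, S.IsBranch c (S.op (S.nx (S.nx e))) ∧ 2 * c.numNodes < k

theorem IsCenter.nx (h : S.IsCenter k e) : S.IsCenter k (S.nx e) :=
  ⟨h.2.1, h.2.2, by simpa using h.1⟩

theorem isBranch_node (ha : S.IsBranch a (S.op e)) (hb : S.IsBranch b (S.op (S.nx e)))
    (hc : S.IsBranch c (S.op (S.nx (S.nx e)))) : S.IsBranch (.node () b c) e :=
  ⟨⟨fun h => ha.op_nx_nx_ne (by simp [h]), fun h => hb.op_nx_nx_ne (by simp [h]),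
    fun h => hc.op_nx_nx_ne (by simp [h])⟩, hb, hc⟩

theorem IsBranch.not_isCenter_place (hS : IsPseudoTree S) (hk : Nat.card S.E = 6 * (k + 1))
    (ht : S.IsBranch t e) (htk : 2 * t.numNodes < k) (x : BranchEnd t) :
    ¬ S.IsCenter k (S.place e x) := by
  intro hx
  obtain ⟨y, s, hy, hs, h⟩ := ht.exists_facing x
  have hst : s.numNodes ≤ t.numNodes := by
    rcases h with rfl | h
    · rw [hs.unique ht]
    · exact h.le
  have hyc : S.IsCenter k y := by
    rcases hy with rfl | rfl | rfl
    · exact hx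
    · exact hx.nx
    · exact hx.nx.nx
  obtain ⟨a, ha, hak⟩ := hyc.1
  have := numNodes_add_numNodes hS hk hs ha
  omega

/-- A center of a pseudo-tree is unique. -/
theorem IsCenter.unique (hS : IsPseudoTree S) (hk : Nat.card S.E = 6 * (k + 1))
    (he : S.IsCenter k e) (hx : S.IsCenter k x) : x = e ∨ x = S.nx e ∨ x = S.nx (S.nx e) := by
  obtain ⟨⟨a, ha, hak⟩, ⟨b, hb, hbk⟩, ⟨c, hc, hck⟩⟩ := he
  rcases exists_place (isBranch_node ha hb hc) ha x with ⟨y, rfl⟩ | ⟨y, rfl⟩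
  · cases y with
    | root => exact .inl rfl
    | fst => exact .inr (.inl rfl)
    | snd => exact .inr (.inr rfl)
    | left y => exact (hb.not_isCenter_place hS hk hbk y hx).elim
    | right y => exact (hc.not_isCenter_place hS hk hck y hx).elim
  · exact (ha.not_isCenter_place hS hk hak y hx).elim

theorem IsBranch.exists_balanced_or_isCenter (hS : IsPseudoTree S)
    (hk : Nat.card S.E = 6 * (k + 1)) (ht : S.IsBranch t e) (hu : S.IsBranch u (S.op e))
    (hut : u.numNodes ≤ t.numNodes) :
    (∃ e l r, S.IsBranch l e ∧ S.IsBranch r (S.op e) ∧ l.numNodes = r.numNodes) ∨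
      ∃ e, S.IsCenter k e := by
  induction t generalizing e u with
  | nil => exact .inl ⟨e, _, _, ht, hu, (Nat.le_zero.1 hut).symm⟩
  | node _ l r ihl ihr =>
    have hsum := numNodes_add_numNodes hS hk ht hu
    rw [BinaryTree.numNodes] at hut hsum
    rcases hut.eq_or_lt with h | h
    · exact .inl ⟨e, _, _, ht, hu, h.symm⟩
    obtain ⟨-, hl, hr⟩ := ht
    by_cases hlk : 2 * l.numNodes < k
    · by_cases hrk : 2 * r.numNodes < k
      · exact .inr ⟨e, ⟨u, hu, by omega⟩, ⟨l, hl, hlk⟩, ⟨r, hr, hrk⟩⟩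
      · refine ihr (u := .node () u l) hr ?_ (by rw [BinaryTree.numNodes]; omega)
        rw [S.op_invol]
        exact isBranch_node hr (by rwa [S.nx_order]) (by rwa [S.nx_order])
    · refine ihl (u := .node () r u) hl ?_ (by rw [BinaryTree.numNodes]; omega)
      rw [S.op_invol]
      exact isBranch_node hl hr (by rwa [S.nx_order])

theorem exists_balanced_or_isCenter (hS : IsPseudoTree S) (hk : Nat.card S.E = 6 * (k + 1)) :
    (∃ e l r, S.IsBranch l e ∧ S.IsBranch r (S.op e) ∧ l.numNodes = r.numNodes) ∨
      ∃ e, S.IsCenter k e := by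
  obtain ⟨e, he, t, ht⟩ := exists_isBranch_nil hS
  exact ht.exists_balanced_or_isCenter hS hk (by rwa [S.op_invol]) (Nat.zero_le _)

/-- Automorphisms correspond to the ends that look like a given one. -/
theorem card_ribbonAut (hS : IsPseudoTree S) (hl : S.IsBranch l e) (hr : S.IsBranch r (S.op e)) :
    Nat.card (ribbonAut S) = Nat.card {x // S.IsBranch l x ∧ S.IsBranch r (S.op x)} := by
  have hmem (g : ribbonAut S) : IsIso (g : Equiv.Perm S.E) := mem_ribbonAut_iff.1 g.2
  refine Nat.card_eq_of_bijective (fun g => ⟨g.1 e, (hmem g).isBranch hl, ?_⟩) ⟨?_, ?_⟩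
  · rw [← (hmem g).1]
    exact (hmem g).isBranch hr
  · intro g g' h
    exact Subtype.ext ((hmem g).eq_of_apply_eq (hmem g') (congrArg Subtype.val h))
  · rintro ⟨x, hlx, hrx⟩
    obtain ⟨f, hf, rfl⟩ := exists_isIso hS hS hl hr hlx hrx
    exact ⟨⟨f, mem_ribbonAut_iff.2 hf⟩, rfl⟩

open Classical in
theorem card_ribbonAut_of_balanced (hS : IsPseudoTree S) (hk : Nat.card S.E = 6 * (k + 1))
    (hl : S.IsBranch l e) (hr : S.IsBranch r (S.op e)) (hlr : l.numNodes = r.numNodes) :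
    Nat.card (ribbonAut S) = if l = r then 2 else 1 := by
  rw [card_ribbonAut hS hl hr]
  change Set.ncard {x | S.IsBranch l x ∧ S.IsBranch r (S.op x)} = _
  split_ifs with h
  · subst h
    rw [← Set.ncard_pair (S.op_free e).symm]
    congr 1
    ext x
    refine ⟨fun hx => eq_or_eq_op_of_balanced hS hk hl hr rfl hx.1 hx.2 rfl, ?_⟩
    rintro (rfl | rfl)
    · exact ⟨hl, hr⟩
    · exact ⟨hr, by rwa [S.op_invol]⟩
  · rw [← Set.ncard_singleton e]
    congr 1
    ext x
    refine ⟨fun hx => ?_, ?_⟩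
    · refine (eq_or_eq_op_of_balanced hS hk hl hr hlr hx.1 hx.2 hlr).resolve_right ?_
      rintro rfl
      exact h (hx.1.unique hr)
    · rintro rfl
      exact ⟨hl, hr⟩

open Classical in
theorem card_ribbonAut_of_isCenter (hS : IsPseudoTree S) (hk : Nat.card S.E = 6 * (k + 1))
    (he : S.IsCenter k e) (ha : S.IsBranch a (S.op e)) (hb : S.IsBranch b (S.op (S.nx e)))
    (hc : S.IsBranch c (S.op (S.nx (S.nx e)))) :
    Nat.card (ribbonAut S) = if a = b ∧ b = c then 3 else 1 := by
  rw [card_ribbonAut hS (isBranch_node ha hb hc) ha]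
  change Set.ncard {x | S.IsBranch (.node () b c) x ∧ S.IsBranch a (S.op x)} = _
  have hsub : ∀ x, S.IsBranch (.node () b c) x → S.IsBranch a (S.op x) →
      x = e ∨ x = S.nx e ∨ x = S.nx (S.nx e) := by
    intro x hx hxa
    refine IsCenter.unique hS hk he ⟨⟨a, hxa, ?_⟩, ⟨b, hx.2.1, ?_⟩, ⟨c, hx.2.2, ?_⟩⟩
    · obtain ⟨a', ha', h⟩ := he.1
      rwa [ha.unique ha']
    · obtain ⟨b', hb', h⟩ := he.2.1
      rwa [hb.unique hb']
    · obtain ⟨c', hc', h⟩ := he.2.2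
      rwa [hc.unique hc']
  split_ifs with h
  · obtain ⟨rfl, rfl⟩ := h
    have hcard : Set.ncard {e, S.nx e, S.nx (S.nx e)} = 3 :=
      Set.ncard_eq_three.2 ⟨_, _, _, (S.nx_free e).symm, (nx_nx_ne e).symm,
        (S.nx_free (S.nx e)).symm, rfl⟩
    rw [← hcard]
    congr 1
    ext x
    refine ⟨fun hx => hsub x hx.1 hx.2, ?_⟩
    rintro (rfl | rfl | rfl)
    · exact ⟨isBranch_node ha hb hc, ha⟩
    · exact ⟨isBranch_node hb hc (by rwa [S.nx_order]), hb⟩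
    · exact ⟨isBranch_node hc (by rwa [S.nx_order]) (by rwa [S.nx_order]), hc⟩
  · rw [← Set.ncard_singleton e]
    congr 1
    ext x
    refine ⟨fun hx => ?_, ?_⟩
    · obtain ⟨hx, hxa⟩ := hx
      rcases hsub x hx hxa with rfl | rfl | rfl
      · rfl
      · exact (h ⟨hxa.unique hb, hx.2.1.unique hc⟩).elim
      · have h₁ := hx.2.1
        have h₂ := hx.2.2
        rw [S.nx_order] at h₁ h₂
        have h₃ := h₁.unique ha
        have h₄ := h₂.unique hb
        exact (h ⟨h₃.symm, h₄.symm⟩).elim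
    · rintro rfl
      exact ⟨isBranch_node ha hb hc, ha⟩

/-- The automorphism group of a pseudo-tree, according to its central edge or node. -/
theorem card_ribbonAut_cases (hS : IsPseudoTree S) (hk : Nat.card S.E = 6 * (k + 1)) :
    Nat.card (ribbonAut S) = 1 ∨
      (Nat.card (ribbonAut S) = 2 ∧ ∃ e t, S.IsBranch t e ∧ S.IsBranch t (S.op e)) ∨
      (Nat.card (ribbonAut S) = 3 ∧
        ∃ e t, S.IsBranch (.node () t t) e ∧ S.IsBranch t (S.op e)) := by
  rcases exists_balanced_or_isCenter hS hk with ⟨e, l, r, hl, hr, hlr⟩ | ⟨e, he⟩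
  · have := card_ribbonAut_of_balanced hS hk hl hr hlr
    split_ifs at this with h
    · subst h
      exact .inr (.inl ⟨this, e, l, hl, hr⟩)
    · exact .inl this
  · obtain ⟨⟨a, ha, -⟩, ⟨b, hb, -⟩, ⟨c, hc, -⟩⟩ := id he
    have := card_ribbonAut_of_isCenter hS hk he ha hb hc
    split_ifs at this with h
    · obtain ⟨rfl, rfl⟩ := h
      exact .inr (.inr ⟨this, e, a, isBranch_node ha hb hc, ha⟩)
    · exact .inl this

theorem isCenter_of_isBranch (hS : IsPseudoTree S) (hk : Nat.card S.E = 6 * (k + 1))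
    (h : S.IsBranch (.node () t t) e) (h' : S.IsBranch t (S.op e)) : S.IsCenter k e := by
  have := numNodes_add_numNodes hS hk h h'
  rw [BinaryTree.numNodes] at this
  exact ⟨⟨t, h', by omega⟩, ⟨t, h.2.1, by omega⟩, ⟨t, h.2.2, by omega⟩⟩

theorem card_isBranch_nil (hS : IsPseudoTree S) (hk : Nat.card S.E = 6 * (k + 1)) :
    Nat.card {e // S.IsBranch .nil e} = k + 2 := by
  have : Nat.card {e // S.IsBranch .nil e} = Nat.card {e // S.z e = e} :=
    Nat.card_congr (S.nx.subtypeEquiv fun e => z_eq_self_iff.symm)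
  have := hS.2
  omega

end ThreeSkeleton

open ThreeSkeleton

theorem sptIso_equivalence (k : ℕ) : Equivalence (SPTIso (k := k)) where
  refl _ := ⟨.refl _, fun _ => rfl, fun _ => rfl⟩
  symm := fun ⟨f, hf⟩ => ⟨f.symm, IsIso.symm hf⟩
  trans := fun ⟨f, hf⟩ ⟨g, hg⟩ => ⟨f.trans g, IsIso.trans hf hg⟩

theorem SPTIso.card_ribbonAut_eq {k : ℕ} {A B : SizedPseudoTree k} (h : SPTIso A B) :
    Nat.card (ribbonAut A.Sk) = Nat.card (ribbonAut B.Sk) := by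
  obtain ⟨f, hf⟩ := h
  replace hf : IsIso f := hf
  refine Nat.card_congr (f.permCongr.subtypeEquiv fun g => ?_)
  simp only [mem_ribbonAut_iff]
  refine ⟨fun hg => (hf.symm.trans hg).trans hf, fun hg => ?_⟩
  have : g = (f.trans (f.permCongr g)).trans f.symm := by
    ext x
    simp
  rw [this]
  exact (hf.trans hg).trans hf.symm

/-- Two glued branches as a pseudo-tree of given size. -/
noncomputable def SizedPseudoTree.glue {k : ℕ} (l r : BinaryTree Unit)
    (h : l.numNodes + r.numNodes = k) : SizedPseudoTree k where
  Sk := ThreeSkeleton.glue l r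
  isPT := isPseudoTree_glue l r
  size := by rw [card_glue, h]

theorem sptIso_glue_iff {k : ℕ} {l r : BinaryTree Unit} (h : l.numNodes + r.numNodes = k)
    (A : SizedPseudoTree k) : SPTIso (.glue l r h) A ↔
      ∃ e, A.Sk.IsBranch l e ∧ A.Sk.IsBranch r (A.Sk.op e) := by
  refine ⟨fun ⟨f, hf⟩ => ⟨f (glueRoot l r), ?_, ?_⟩, fun ⟨e, hl, hr⟩ => ?_⟩
  · exact IsIso.isBranch hf (isBranch_glueRoot l r)
  · exact hf.1 (glueRoot l r) ▸ IsIso.isBranch hf (isBranch_op_glueRoot l r)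
  · obtain ⟨f, hf, -⟩ := exists_isIso_glue A.isPT hl hr
    exact ⟨f, hf⟩

theorem card_trees (n : ℕ) : Nat.card {t : BinaryTree Unit // t.numNodes = n} = catalan n := by
  rw [← BinaryTree.treesOfNumNodesEq_card_eq_catalan]
  exact Nat.subtype_card _ fun _ => BinaryTree.mem_treesOfNumNodesEq

theorem TNum_two (k : ℕ) : TNum k 2 = if 2 ∣ k then catalan (k / 2) else 0 := by
  split_ifs with h
  · rw [← card_trees]
    symm
    have hcard (t : BinaryTree Unit) (ht : t.numNodes + t.numNodes = k) :
        Nat.card (ribbonAut (SizedPseudoTree.glue t t ht).Sk) = 2 :=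
      (card_ribbonAut_of_balanced (isPseudoTree_glue t t) (SizedPseudoTree.glue t t ht).size
        (isBranch_glueRoot t t) (isBranch_op_glueRoot t t) rfl).trans (if_pos rfl)
    have hsize (t : {t : BinaryTree Unit // t.numNodes = k / 2}) :
        t.1.numNodes + t.1.numNodes = k := by
      omega
    refine Nat.card_eq_of_bijective
      (fun t => Quot.mk _ ⟨.glue t.1 t.1 (hsize t), hcard t.1 (hsize t)⟩) ⟨?_, ?_⟩
    · intro t t' hq
      have hq := (((sptIso_equivalence k).comap Subtype.val).quot_mk_eq_iff _ _).1 hq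
      obtain ⟨e, he, he'⟩ := (sptIso_glue_iff (hsize t) _).1 hq
      refine Subtype.ext ?_
      rcases eq_or_eq_op_of_balanced (isPseudoTree_glue t'.1 t'.1)
        (SizedPseudoTree.glue t'.1 t'.1 (hsize t')).size (isBranch_glueRoot t'.1 t'.1)
        (isBranch_op_glueRoot t'.1 t'.1) rfl he he' rfl with rfl | rfl
      · exact he.unique (isBranch_glueRoot t'.1 t'.1)
      · exact he.unique (isBranch_op_glueRoot t'.1 t'.1)
    · rintro ⟨A, hA⟩
      rcases card_ribbonAut_cases A.isPT A.size with h' | ⟨-, e, t, he, he'⟩ | ⟨h', -⟩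
      · omega
      · have := numNodes_add_numNodes A.isPT A.size he he'
        exact ⟨⟨t, by omega⟩, Quot.sound ((sptIso_glue_iff (hsize ⟨t, by omega⟩) A).2 ⟨e, he, he'⟩)⟩
      · omega
  · rw [TNum, Nat.card_eq_zero]
    refine .inl ⟨?_⟩
    rintro ⟨A, hA⟩
    rcases card_ribbonAut_cases A.isPT A.size with h' | ⟨-, e, t, he, he'⟩ | ⟨h', -⟩
    · omega
    · have := numNodes_add_numNodes A.isPT A.size he he'
      omega
    · omega

theorem TNum_three (k : ℕ) : TNum k 3 = if k % 3 = 1 then catalan ((k - 1) / 3) else 0 := by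
  have hnode (t : BinaryTree Unit) :
      (BinaryTree.node () t t).numNodes + t.numNodes = 3 * t.numNodes + 1 := by
    rw [BinaryTree.numNodes]
    ring
  split_ifs with h
  · rw [← card_trees]
    symm
    have hcard (t : BinaryTree Unit) (ht : (BinaryTree.node () t t).numNodes + t.numNodes = k) :
        Nat.card (ribbonAut (SizedPseudoTree.glue (.node () t t) t ht).Sk) = 3 := by
      have h₁ := isBranch_glueRoot (.node () t t) t
      have h₂ := isBranch_op_glueRoot (.node () t t) t
      have h₃ := (SizedPseudoTree.glue (.node () t t) t ht).size
      exact (card_ribbonAut_of_isCenter (isPseudoTree_glue _ _) h₃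
        (isCenter_of_isBranch (isPseudoTree_glue _ _) h₃ h₁ h₂) h₂ h₁.2.1 h₁.2.2).trans
        (if_pos ⟨rfl, rfl⟩)
    have hsize (t : {t : BinaryTree Unit // t.numNodes = (k - 1) / 3}) :
        (BinaryTree.node () t.1 t.1).numNodes + t.1.numNodes = k := by
      rw [hnode, t.2]
      omega
    refine Nat.card_eq_of_bijective
      (fun t => Quot.mk _ ⟨.glue (.node () t.1 t.1) t.1 (hsize t), hcard t.1 (hsize t)⟩) ⟨?_, ?_⟩
    · intro t t' hq
      have hq := (((sptIso_equivalence k).comap Subtype.val).quot_mk_eq_iff _ _).1 hq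
      obtain ⟨e, he, he'⟩ := (sptIso_glue_iff (hsize t) _).1 hq
      refine Subtype.ext ?_
      have h₁ := isBranch_glueRoot (.node () t'.1 t'.1) t'.1
      have h₂ := isBranch_op_glueRoot (.node () t'.1 t'.1) t'.1
      have h₃ := (SizedPseudoTree.glue (.node () t'.1 t'.1) t'.1 (hsize t')).size
      rcases IsCenter.unique (isPseudoTree_glue _ _) h₃
        (isCenter_of_isBranch (isPseudoTree_glue _ _) h₃ h₁ h₂)
        (isCenter_of_isBranch (isPseudoTree_glue _ _) h₃ he he') with rfl | rfl | rfl
      · exact he'.unique h₂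
      · exact he'.unique h₁.2.1
      · exact he'.unique h₁.2.2
    · rintro ⟨A, hA⟩
      rcases card_ribbonAut_cases A.isPT A.size with h' | ⟨h', -⟩ | ⟨-, e, t, he, he'⟩
      · omega
      · omega
      · have := numNodes_add_numNodes A.isPT A.size he he'
        rw [hnode] at this
        exact ⟨⟨t, by omega⟩, Quot.sound ((sptIso_glue_iff (hsize ⟨t, by omega⟩) A).2 ⟨e, he, he'⟩)⟩
  · rw [TNum, Nat.card_eq_zero]
    refine .inl ⟨?_⟩
    rintro ⟨A, hA⟩
    rcases card_ribbonAut_cases A.isPT A.size with h' | ⟨h', -⟩ | ⟨-, e, t, he, he'⟩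
    · omega
    · omega
    · have := numNodes_add_numNodes A.isPT A.size he he'
      rw [hnode] at this
      omega

theorem TNum_eq_zero (k : ℕ) {i : ℕ} (hi : 3 < i) : TNum k i = 0 := by
  rw [TNum, Nat.card_eq_zero]
  refine .inl ⟨?_⟩
  rintro ⟨A, hA⟩
  rcases card_ribbonAut_cases A.isPT A.size with h' | ⟨h', -⟩ | ⟨h', -⟩ <;> omega

/-- Isomorphism of pseudo-trees as a setoid. -/
def sptSetoid (k : ℕ) : Setoid (SizedPseudoTree k) := ⟨SPTIso, sptIso_equivalence k⟩

/-- The order of the automorphism group of an isomorphism class. -/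
noncomputable def autOrder {k : ℕ} : Quotient (sptSetoid k) → ℕ :=
  Quotient.lift (fun A => Nat.card (ribbonAut A.Sk)) fun _ _ h => SPTIso.card_ribbonAut_eq h

theorem TNum_eq_card (k i : ℕ) : TNum k i = Nat.card {q // autOrder (k := k) q = i} := by
  refine Nat.card_eq_of_bijective (Quot.lift (fun A => ⟨Quotient.mk (sptSetoid k) A.1, A.2⟩)
    fun _ _ h => Subtype.ext (Quotient.sound h)) ⟨?_, ?_⟩
  · rintro ⟨A⟩ ⟨B⟩ h
    exact Quot.sound (Quotient.exact (congrArg Subtype.val h))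
  · rintro ⟨⟨A⟩, hA⟩
    exact ⟨Quot.mk _ ⟨A, hA⟩, rfl⟩

/-- The isomorphism class of the pseudo-tree with a marked leaf described by a binary tree. -/
noncomputable def leafClass (k : ℕ) (t : {t : BinaryTree Unit // t.numNodes = k}) :
    Quotient (sptSetoid k) :=
  Quotient.mk _ (.glue .nil t.1 (by simp [t.2]))

theorem leafClass_eq_iff {k : ℕ} (t : {t : BinaryTree Unit // t.numNodes = k})
    (A : SizedPseudoTree k) : leafClass k t = Quotient.mk _ A ↔
      ∃ e, A.Sk.IsBranch .nil e ∧ A.Sk.IsBranch t.1 (A.Sk.op e) :=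
  Quotient.eq.trans (sptIso_glue_iff _ A)

theorem leafClass_surjective (k : ℕ) : (leafClass k).Surjective := by
  rintro ⟨A⟩
  obtain ⟨e, he, t, ht⟩ := exists_isBranch_nil A.isPT
  have := numNodes_add_numNodes A.isPT A.size he ht
  exact ⟨⟨t, by simpa using this⟩, (leafClass_eq_iff _ A).2 ⟨e, he, ht⟩⟩

instance finite_trees (k : ℕ) : Finite {t : BinaryTree Unit // t.numNodes = k} :=
  Set.Finite.to_subtype <| (BinaryTree.treesOfNumNodesEq k).finite_toSet.subset fun _ ht =>
    BinaryTree.mem_treesOfNumNodesEq.2 ht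

/-- A pseudo-tree has `k + 2` leaves, on which its automorphism group acts freely. -/
theorem card_leafClass_fiber_mul {k : ℕ} (q : Quotient (sptSetoid k)) :
    Nat.card {t // leafClass k t = q} * autOrder q = k + 2 := by
  obtain ⟨A⟩ := q
  have := Fintype.ofFinite {t // leafClass k t = Quotient.mk _ A}
  let F := {t // leafClass k t = Quotient.mk _ A}
  let proj : (Σ t : F, {e // A.Sk.IsBranch .nil e ∧ A.Sk.IsBranch t.1.1 (A.Sk.op e)}) →
    {e // A.Sk.IsBranch .nil e} := fun p => ⟨p.2.1, p.2.2.1⟩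
  have hproj : proj.Bijective := by
    refine ⟨?_, ?_⟩
    · rintro ⟨⟨⟨t, ht⟩, ht'⟩, ⟨e, he, het⟩⟩ ⟨⟨⟨u, hu⟩, hu'⟩, ⟨e', he', heu⟩⟩ h
      obtain rfl : e = e' := congrArg Subtype.val h
      obtain rfl : t = u := het.unique heu
      rfl
    · rintro ⟨e, he⟩
      obtain ⟨l, t, -, ht⟩ := exists_isBranch A.isPT e he.op_ne_nx he.op_nx_nx_ne
      have := numNodes_add_numNodes A.isPT A.size he ht
      exact ⟨⟨⟨⟨t, by simpa using this⟩, (leafClass_eq_iff _ A).2 ⟨e, he, ht⟩⟩, ⟨e, he, ht⟩⟩, rfl⟩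
  rw [← card_isBranch_nil A.isPT A.size, ← Nat.card_eq_of_bijective proj hproj, Nat.card_sigma]
  have hF (t : F) : Nat.card {e // A.Sk.IsBranch .nil e ∧ A.Sk.IsBranch t.1.1 (A.Sk.op e)} =
      Nat.card (ribbonAut A.Sk) := by
    obtain ⟨e, he, ht⟩ := (leafClass_eq_iff _ A).1 t.2
    exact (card_ribbonAut A.isPT he ht).symm
  simp only [hF, Finset.sum_const, Finset.card_univ, smul_eq_mul, ← Nat.card_eq_fintype_card]
  rfl

theorem autOrder_cases {k : ℕ} (q : Quotient (sptSetoid k)) :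
    autOrder q = 1 ∨ autOrder q = 2 ∨ autOrder q = 3 := by
  obtain ⟨A⟩ := q
  exact (card_ribbonAut_cases A.isPT A.size).imp_right (.imp And.left And.left)

open Classical in
theorem TNum_sum (k : ℕ) : (TNum k 1 : ℚ) + (TNum k 2 : ℚ) / 2 + (TNum k 3 : ℚ) / 3 =
    (catalan k : ℚ) / (k + 2) := by
  have := Finite.of_surjective _ (leafClass_surjective k)
  have := Fintype.ofFinite (Quotient (sptSetoid k))
  have hT (i : ℕ) :
      (TNum k i : ℚ) = ∑ q : Quotient (sptSetoid k), if autOrder q = i then 1 else 0 := by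
    rw [TNum_eq_card, Nat.card_eq_fintype_card, Fintype.card_subtype, Finset.sum_boole]
  have hC : (catalan k : ℚ) = ∑ q, (Nat.card {t // leafClass k t = q} : ℚ) := by
    rw [← card_trees, ← Nat.card_congr (Equiv.sigmaFiberEquiv (leafClass k)), Nat.card_sigma]
    push_cast
    rfl
  rw [hT, hT, hT, hC, Finset.sum_div, Finset.sum_div, Finset.sum_div, ← Finset.sum_add_distrib,
    ← Finset.sum_add_distrib]
  refine Finset.sum_congr rfl fun q _ => ?_
  have hq : (Nat.card {t // leafClass k t = q} : ℚ) * autOrder q = k + 2 := by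
    exact_mod_cast card_leafClass_fiber_mul q
  rw [eq_div_iff (by positivity), ← hq]
  rcases autOrder_cases q with h | h | h <;> rw [h] <;> norm_num <;> ring

theorem stmt_17 (k : ℕ) :
    (∀ i : ℕ, 3 < i → TNum k i = 0) ∧
    TNum k 2 = (if 2 ∣ k then catalan (k / 2) else 0) ∧
    TNum k 3 = (if k % 3 = 1 then catalan ((k - 1) / 3) else 0) ∧
    (TNum k 1 : ℚ) + (TNum k 2 : ℚ) / 2 + (TNum k 3 : ℚ) / 3 =
      (catalan k : ℚ) / (k + 2) := by
  exact ⟨fun _ hi => TNum_eq_zero k hi, TNum_two k, TNum_three k, TNum_sum k⟩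
end
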